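/- arXiv:2209.09299 — 3 statements merged into one kernel-verified Lean document; each statement's English description precedes it below -/
import Mathlib

section
/- Let H_{τ,u^rel} denote the orthogonal projection onto the column span of (X_τ, u^rel), and set γ²_{(u^rel,τ₀)} = 1 − min over models τ with |τ| < |τ₀| of ‖(I−H_{τ,u^rel})X_{τ₀}β₀‖²/‖(I−H_τ)X_{τ₀}β₀‖²; this quantity is < 1. Assume u^rel does not lie in the column span of (X_{τ₀}, X_τ) for any model τ with |τ| ≤ |τ₀|. Then for every λ with 0 < λ < n·(1 − γ²_{(u^rel,τ₀)})·C_min: (i) τ₀ is the unique minimizer over models τ of min over β_τ ∈ ℝ^{|τ|} and σ ∈ ℝ of ‖y_obs − X_τβ_τ − σu^rel‖² + λ|τ|; and (ii) (τ₀, β₀, σ₀) minimizes ‖y_obs − X_τβ_τ − σu^rel‖² + λ|τ| over all triples (τ, β_τ, σ). -/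
open MeasureTheory ProbabilityTheory Matrix Filter
open scoped ENNReal Classical

noncomputable section

namespace ReproSamples

/-- Squared Euclidean norm of a vector in `ℝⁿ`. -/
def sqnorm {n : ℕ} (v : Fin n → ℝ) : ℝ := ∑ i, (v i) ^ 2

/-- The vector `β` with all coordinates outside `τ` set to `0`; this encodes the
vector `β_τ ∈ ℝ^{|τ|}`, so that `X_τ β_τ = X.mulVec (maskOn τ β)`. -/
def maskOn {p : ℕ} (τ : Finset (Fin p)) (β : Fin p → ℝ) : Fin p → ℝ :=
  fun j => if j ∈ τ then β j else 0

/-- The submatrix `X_τ` of the columns of `X` indexed by `τ`. -/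
def subcols {n p : ℕ} (X : Matrix (Fin n) (Fin p) ℝ) (τ : Finset (Fin p)) :
    Matrix (Fin n) {j // j ∈ τ} ℝ :=
  Matrix.of fun i j => X i j.1

/-- The matrix `M (MᵀM)⁻¹ Mᵀ` (orthogonal projection onto the column span of `M`
when `MᵀM` is invertible). -/
def projMat {n : ℕ} {m : Type} [Fintype m] [DecidableEq m]
    (M : Matrix (Fin n) m ℝ) : Matrix (Fin n) (Fin n) ℝ :=
  M * (Mᵀ * M)⁻¹ * Mᵀ

/-- The projection matrix `H_τ = X_τ (X_τᵀ X_τ)⁻¹ X_τᵀ`. -/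
def proj {n p : ℕ} (X : Matrix (Fin n) (Fin p) ℝ) (τ : Finset (Fin p)) :
    Matrix (Fin n) (Fin n) ℝ :=
  projMat (subcols X τ)

/-- Identifiability: `τ₀` is the unique minimizer of `|τ|` over
`{τ : X_τ β_τ = X_{τ₀} β₀ for some β_τ}` (here `β₀` is supported on `τ₀`). -/
def Identifiable {n p : ℕ} (X : Matrix (Fin n) (Fin p) ℝ) (τ₀ : Finset (Fin p))
    (β₀ : Fin p → ℝ) : Prop :=
  ∀ τ : Finset (Fin p), (∃ β : Fin p → ℝ, X.mulVec (maskOn τ β) = X.mulVec β₀) →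
    τ ≠ τ₀ → τ₀.card < τ.card

/-- The separation constant `C_min`. -/
def Cmin {n p : ℕ} (X : Matrix (Fin n) (Fin p) ℝ) (τ₀ : Finset (Fin p))
    (β₀ : Fin p → ℝ) : ℝ :=
  sInf ((fun τ : Finset (Fin p) =>
      sqnorm ((1 - proj X τ).mulVec (X.mulVec β₀)) /
        ((n * max (τ₀ \ τ).card 1 : ℕ) : ℝ)) ''
    {τ : Finset (Fin p) | τ ≠ τ₀ ∧ τ.card ≤ τ₀.card})

/-- Penalized objective `min_{β_τ, σ} ‖y − X_τ β_τ − σ u*‖² + λ|τ|`. -/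
def objPen {n p : ℕ} (X : Matrix (Fin n) (Fin p) ℝ) (lam : ℝ) (y ustar : Fin n → ℝ)
    (τ : Finset (Fin p)) : ℝ :=
  (⨅ bs : (Fin p → ℝ) × ℝ, sqnorm (y - X.mulVec (maskOn τ bs.1) - bs.2 • ustar)) +
    lam * τ.card

/-- Un-penalized objective `min_{β_τ, σ} ‖y − X_τ β_τ − σ u*‖²`. -/
def objFit {n p : ℕ} (X : Matrix (Fin n) (Fin p) ℝ) (y ustar : Fin n → ℝ)
    (τ : Finset (Fin p)) : ℝ :=
  ⨅ bs : (Fin p → ℝ) × ℝ, sqnorm (y - X.mulVec (maskOn τ bs.1) - bs.2 • ustar)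

/-- Standard Gaussian measure `N(0, I_n)` on `ℝⁿ`. -/
def stdGaussian (n : ℕ) : Measure (Fin n → ℝ) :=
  Measure.pi fun _ => gaussianReal 0 1

/-- Joint law of `(U, (U*_1, …, U*_d))`, all i.i.d. `N(0, I_n)`. -/
def jointMeasure (n d : ℕ) : Measure ((Fin n → ℝ) × (Fin d → Fin n → ℝ)) :=
  (stdGaussian n).prod (Measure.pi fun _ : Fin d => stdGaussian n)

/-- Squared cosine of the angle between two vectors. -/
def rho {n : ℕ} (v w : Fin n → ℝ) : ℝ := (v ⬝ᵥ w) ^ 2 / (sqnorm v * sqnorm w)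

/-- `ρ_{τ⊥}(v, w) = ρ((I−H_τ)v, (I−H_τ)w)`. -/
def rhoPerp {n p : ℕ} (X : Matrix (Fin n) (Fin p) ℝ) (τ : Finset (Fin p))
    (v w : Fin n → ℝ) : ℝ :=
  rho ((1 - proj X τ).mulVec v) ((1 - proj X τ).mulVec w)

/-- `ρ(v, τ) = ‖H_τ v‖²/‖v‖²`. -/
def rhoTau {n p : ℕ} (X : Matrix (Fin n) (Fin p) ℝ) (v : Fin n → ℝ)
    (τ : Finset (Fin p)) : ℝ :=
  sqnorm ((proj X τ).mulVec v) / sqnorm v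

/-- The augmented matrix `(X_τ, u)`. -/
def augcols {n p : ℕ} (X : Matrix (Fin n) (Fin p) ℝ) (τ : Finset (Fin p))
    (u : Fin n → ℝ) : Matrix (Fin n) ({j // j ∈ τ} ⊕ Unit) ℝ :=
  Matrix.of fun i j => Sum.elim (fun k : {j // j ∈ τ} => X i k.1) (fun _ => u i) j

/-- The projection matrix `H_{τ,u}` onto the column span of `(X_τ, u)`. -/
def projAug {n p : ℕ} (X : Matrix (Fin n) (Fin p) ℝ) (τ : Finset (Fin p))
    (u : Fin n → ℝ) : Matrix (Fin n) (Fin n) ℝ :=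
  projMat (augcols X τ u)

/-- `γ²_{(u, τ₀)} = 1 − min_{|τ| < |τ₀|} ‖(I−H_{τ,u})X_{τ₀}β₀‖²/‖(I−H_τ)X_{τ₀}β₀‖²`. -/
def gammaSq {n p : ℕ} (X : Matrix (Fin n) (Fin p) ℝ) (τ₀ : Finset (Fin p))
    (β₀ : Fin p → ℝ) (u : Fin n → ℝ) : ℝ :=
  1 - sInf ((fun τ : Finset (Fin p) =>
      sqnorm ((1 - projAug X τ u).mulVec (X.mulVec β₀)) /
        sqnorm ((1 - proj X τ).mulVec (X.mulVec β₀))) ''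
    {τ : Finset (Fin p) | τ.card < τ₀.card})

/-- Residual sum of squares `min_β ‖y − X_τ β‖²`. -/
def rss {n p : ℕ} (X : Matrix (Fin n) (Fin p) ℝ) (y : Fin n → ℝ)
    (τ : Finset (Fin p)) : ℝ :=
  ⨅ β : Fin p → ℝ, sqnorm (y - X.mulVec (maskOn τ β))

/-- `Y*_w = a + b (I−H_τ)u / ‖(I−H_τ)u‖`. -/
def ystar {n p : ℕ} (X : Matrix (Fin n) (Fin p) ℝ) (τ : Finset (Fin p))
    (a : Fin n → ℝ) (b : ℝ) (u : Fin n → ℝ) : Fin n → ℝ :=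
  a + (b / Real.sqrt (sqnorm ((1 - proj X τ).mulVec u))) • ((1 - proj X τ).mulVec u)

/-- `p_{(w,τ)}(τ') = ℙ(T̃(Y*_w, τ) = τ')`. -/
def pfun {n p : ℕ} (X : Matrix (Fin n) (Fin p) ℝ)
    (Tt : (Fin n → ℝ) → Finset (Fin p) → Finset (Fin p))
    (τ : Finset (Fin p)) (a : Fin n → ℝ) (b : ℝ) (τ' : Finset (Fin p)) : ℝ :=
  ((stdGaussian n) {u | Tt (ystar X τ a b u) τ = τ'}).toReal

/-- `B_α(τ, w) = {τ* : ∑_{τ' : p(τ') ≤ p(τ*)} p(τ') ≥ 1 − α}`. -/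
def Bset {n p : ℕ} (X : Matrix (Fin n) (Fin p) ℝ)
    (Tt : (Fin n → ℝ) → Finset (Fin p) → Finset (Fin p)) (α : ℝ)
    (τ : Finset (Fin p)) (a : Fin n → ℝ) (b : ℝ) : Set (Finset (Fin p)) :=
  {τstar | 1 - α ≤
    ∑ τ' ∈ Finset.univ.filter (fun τ' => pfun X Tt τ a b τ' ≤ pfun X Tt τ a b τstar),
      pfun X Tt τ a b τ'}

/-- `τ ∈ Γ̄^τ_α(y)`-membership test: `T̃(y,τ) ∈ B_α(τ, W̃(y,τ))` with
`W̃(y,τ) = (H_τ y, ‖(I−H_τ)y‖)`. -/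
def inCS {n p : ℕ} (X : Matrix (Fin n) (Fin p) ℝ)
    (Tt : (Fin n → ℝ) → Finset (Fin p) → Finset (Fin p)) (α : ℝ)
    (y : Fin n → ℝ) (τ : Finset (Fin p)) : Prop :=
  Tt y τ ∈ Bset X Tt α τ ((proj X τ).mulVec y)
    (Real.sqrt (sqnorm ((1 - proj X τ).mulVec y)))

/-- `O_{τ,Λ}`: orthogonal projection onto the column span of `(I−H_{τ∖Λ}) X_{Λ∩τ}`. -/
def projO {n p : ℕ} (X : Matrix (Fin n) (Fin p) ℝ) (τ Λ : Finset (Fin p)) :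
    Matrix (Fin n) (Fin n) ℝ :=
  projMat ((1 - proj X (τ \ Λ)) * subcols X (Λ ∩ τ))

/-- The nuclear mapping `T̃(y, (β_Λ, τ))` with values in `EReal` (it takes the value
`⊤ = +∞` when `β_i ≠ 0` for some `i ∈ Λ ∖ τ`). -/
def Tnuc {n p : ℕ} (X : Matrix (Fin n) (Fin p) ℝ) (Λ τ : Finset (Fin p))
    (β : Fin p → ℝ) (y : Fin n → ℝ) : EReal :=
  if ∃ i ∈ Λ \ τ, β i ≠ 0 then ⊤
  else if Λ ∩ τ = ∅ then 0
  else ((((y - X.mulVec (maskOn Λ β)) ⬝ᵥ (projO X τ Λ).mulVec (y - X.mulVec (maskOn Λ β))) /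
    (((y - X.mulVec (maskOn Λ β)) ⬝ᵥ (1 - proj X τ).mulVec (y - X.mulVec (maskOn Λ β))) /
      ((n : ℝ) - τ.card)) : ℝ) : EReal)

/-- The statistic `u ↦ (uᵀ O_{τ,Λ} u)/(uᵀ(I−H_τ)u/(n−|τ|))`. -/
def fstat {n p : ℕ} (X : Matrix (Fin n) (Fin p) ℝ) (τ Λ : Finset (Fin p))
    (u : Fin n → ℝ) : ℝ :=
  (u ⬝ᵥ (projO X τ Λ).mulVec u) / ((u ⬝ᵥ (1 - proj X τ).mulVec u) / ((n : ℝ) - τ.card))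

/-- The `α`-quantile `q_α(τ, Λ)` of the law of `fstat` under `N(0, I_n)`. -/
def qant {n p : ℕ} (X : Matrix (Fin n) (Fin p) ℝ) (τ Λ : Finset (Fin p)) (α : ℝ) : ℝ :=
  sInf {x : ℝ | α ≤ (((stdGaussian n).map (fstat X τ Λ)) (Set.Iic x)).toReal}


lemma aux_sqnorm_nonneg {n : ℕ} (v : Fin n → ℝ) : 0 ≤ sqnorm v :=
  Finset.sum_nonneg fun _ _ => sq_nonneg _

lemma aux_sqnorm_eq {n : ℕ} (v : Fin n → ℝ) : sqnorm v = v ⬝ᵥ v := by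
  simp [sqnorm, dotProduct, sq]

lemma aux_proj_le {n : ℕ} {m : Type} [Fintype m] [DecidableEq m]
    (M : Matrix (Fin n) m ℝ) (h : IsUnit (Mᵀ * M).det) (v : Fin n → ℝ) (w : m → ℝ) :
    sqnorm ((1 - projMat M).mulVec v) ≤ sqnorm (v - M.mulVec w) := by
  set r := (1 - projMat M).mulVec v with hr
  set z := ((Mᵀ * M)⁻¹ * Mᵀ).mulVec v - w with hz
  have h1 : v - M.mulVec w = r + M.mulVec z := by
    rw [hr, hz, Matrix.mulVec_sub, Matrix.mulVec_mulVec, Matrix.sub_mulVec, Matrix.one_mulVec,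
      projMat, Matrix.mul_assoc]
    abel
  have h2 : Mᵀ.mulVec r = 0 := by
    rw [hr, Matrix.mulVec_mulVec, Matrix.mul_sub, projMat, ← Matrix.mul_assoc,
      ← Matrix.mul_assoc, Matrix.mul_nonsing_inv _ h]
    simp
  have h3 : r ⬝ᵥ M.mulVec z = 0 := by
    rw [Matrix.dotProduct_mulVec, ← Matrix.mulVec_transpose, h2, zero_dotProduct]
  have h4 := aux_sqnorm_nonneg (M.mulVec z)
  rw [aux_sqnorm_eq] at h4
  rw [h1, aux_sqnorm_eq, aux_sqnorm_eq, add_dotProduct, dotProduct_add, dotProduct_add,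
    dotProduct_comm (M.mulVec z) r, h3]
  linarith

lemma aux_aug {n p : ℕ} (X : Matrix (Fin n) (Fin p) ℝ) (τ : Finset (Fin p))
    (u : Fin n → ℝ) (β : Fin p → ℝ) (s : ℝ) :
    (augcols X τ u).mulVec (Sum.elim (fun k => β k.1) (fun _ => s)) =
      X.mulVec (maskOn τ β) + s • u := by
  ext i
  simp only [Matrix.mulVec, dotProduct, augcols, maskOn, Fintype.sum_sum_type, Matrix.of_apply,
    Sum.elim_inl, Sum.elim_inr, Pi.add_apply, Pi.smul_apply, smul_eq_mul, mul_ite, mul_zero]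
  congr 1
  · rw [← Finset.sum_filter, Finset.filter_mem_eq_inter, Finset.univ_inter]
    exact Finset.sum_coe_sort τ (fun j => X i j * β j)
  · simp [mul_comm]

lemma aux_maskOn_self {p : ℕ} (τ₀ : Finset (Fin p)) (β₀ : Fin p → ℝ)
    (h : ∀ j ∉ τ₀, β₀ j = 0) : maskOn τ₀ β₀ = β₀ := by
  ext j
  by_cases hj : j ∈ τ₀
  · simp [maskOn, hj]
  · simp [maskOn, hj, h j hj]

lemma aux_pos {n p : ℕ} (X : Matrix (Fin n) (Fin p) ℝ) (τ : Finset (Fin p))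
    (y u : Fin n → ℝ) (h : ∀ (β : Fin p → ℝ) (s : ℝ), y ≠ X.mulVec (maskOn τ β) + s • u) :
    0 < ⨅ bs : (Fin p → ℝ) × ℝ, sqnorm (y - X.mulVec (maskOn τ bs.1) - bs.2 • u) := by
  set L := (augcols X τ u).mulVecLin with hL
  have hc : IsClosed (L.range : Set (Fin n → ℝ)) := Submodule.closed_of_finiteDimensional _
  have hy : y ∈ (L.range : Set (Fin n → ℝ))ᶜ := by
    rintro ⟨w, hw⟩
    refine h (fun j => if hj : j ∈ τ then w (Sum.inl ⟨j, hj⟩) else 0) (w (Sum.inr ())) ?_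
    rw [← aux_aug, ← hw, hL, Matrix.mulVecLin_apply]
    congr 1
    ext (k | k) <;> simp
  obtain ⟨ε, hε, hb⟩ := Metric.isOpen_iff.1 hc.isOpen_compl y hy
  refine lt_of_lt_of_le (pow_pos hε 2) (le_ciInf fun bs => ?_)
  by_contra! hlt
  have hm : X.mulVec (maskOn τ bs.1) + bs.2 • u ∈ Metric.ball y ε := by
    rw [Metric.mem_ball, dist_comm, dist_pi_lt_iff hε]
    intro i
    rw [Real.dist_eq]
    apply abs_lt_of_sq_lt_sq _ hε.le
    refine lt_of_le_of_lt ?_ hlt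
    have := Finset.single_le_sum (s := Finset.univ)
      (f := fun i => ((y - X.mulVec (maskOn τ bs.1) - bs.2 • u) i) ^ 2)
      (fun _ _ => sq_nonneg _) (Finset.mem_univ i)
    refine le_trans (le_of_eq ?_) this
    simp [sub_sub]
  refine hb hm ⟨Sum.elim (fun k => bs.1 k.1) (fun _ => bs.2), ?_⟩
  rw [hL, Matrix.mulVecLin_apply, aux_aug]

/-- **Lemma 2.1.** Given the realized error `u^rel` (not in the span of
`(X_{τ₀}, X_τ)` for any `|τ| ≤ |τ₀|`), for any
`0 < λ < n (1 − γ²_{(u^rel,τ₀)}) C_min`, the true model `τ₀` is the unique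
minimizer of the penalized objective, and `(τ₀, β₀, σ₀)` minimizes
`‖y_obs − X_τ β_τ − σ u^rel‖² + λ|τ|` over all triples `(τ, β_τ, σ)`. -/
theorem true_model_penalized_recovery {n p : ℕ}
    (X : Matrix (Fin n) (Fin p) ℝ) (τ₀ : Finset (Fin p)) (β₀ : Fin p → ℝ)
    (hβsupp : ∀ j ∉ τ₀, β₀ j = 0) (hβne : ∀ j ∈ τ₀, β₀ j ≠ 0)
    (σ₀ : ℝ) (hσ₀ : 0 < σ₀)
    (urel : Fin n → ℝ)
    (yobs : Fin n → ℝ) (hy : yobs = X.mulVec β₀ + σ₀ • urel)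
    (hid : Identifiable X τ₀ β₀)
    (hGram : ∀ τ : Finset (Fin p), τ.card ≤ τ₀.card →
      IsUnit ((subcols X τ)ᵀ * subcols X τ).det)
    (hGramAug : ∀ τ : Finset (Fin p), τ.card < τ₀.card →
      IsUnit ((augcols X τ urel)ᵀ * augcols X τ urel).det)
    (hspan : ∀ τ : Finset (Fin p), τ.card ≤ τ₀.card →
      ∀ b c : Fin p → ℝ, urel ≠ X.mulVec (maskOn τ₀ b) + X.mulVec (maskOn τ c))
    (lam : ℝ) (hlam₀ : 0 < lam)
    (hlam₁ : lam < (n : ℝ) * (1 - gammaSq X τ₀ β₀ urel) * Cmin X τ₀ β₀) :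
    ((∀ τ : Finset (Fin p), objPen X lam yobs urel τ₀ ≤ objPen X lam yobs urel τ) ∧
      (∀ τ : Finset (Fin p), τ ≠ τ₀ →
        objPen X lam yobs urel τ₀ < objPen X lam yobs urel τ)) ∧
    (∀ (τ : Finset (Fin p)) (β : Fin p → ℝ) (σ : ℝ),
      sqnorm (yobs - X.mulVec (maskOn τ₀ β₀) - σ₀ • urel) + lam * τ₀.card ≤
        sqnorm (yobs - X.mulVec (maskOn τ β) - σ • urel) + lam * τ.card) := by
  have hmask := aux_maskOn_self τ₀ β₀ hβsupp
  have hbdd : ∀ τ : Finset (Fin p), BddBelow (Set.range fun bs : (Fin p → ℝ) × ℝ =>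
      sqnorm (yobs - X.mulVec (maskOn τ bs.1) - bs.2 • urel)) := by
    intro τ
    refine ⟨0, ?_⟩
    rintro _ ⟨bs, rfl⟩
    exact aux_sqnorm_nonneg _
  have hzero : sqnorm (yobs - X.mulVec (maskOn τ₀ β₀) - σ₀ • urel) = 0 := by
    rw [hmask, hy]
    simp [sqnorm]
  have hobj0 : objPen X lam yobs urel τ₀ = lam * τ₀.card := by
    have h1 := ciInf_le (hbdd τ₀) (β₀, σ₀)
    have h2 : 0 ≤ ⨅ bs : (Fin p → ℝ) × ℝ,
        sqnorm (yobs - X.mulVec (maskOn τ₀ bs.1) - bs.2 • urel) :=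
      le_ciInf fun bs => aux_sqnorm_nonneg _
    simp only [hzero] at h1
    rw [objPen, le_antisymm h1 h2, zero_add]
  have hstrict : ∀ τ : Finset (Fin p), τ ≠ τ₀ →
      objPen X lam yobs urel τ₀ < objPen X lam yobs urel τ := by
    intro τ hne
    rw [hobj0, objPen]
    have h2 : 0 ≤ ⨅ bs : (Fin p → ℝ) × ℝ,
        sqnorm (yobs - X.mulVec (maskOn τ bs.1) - bs.2 • urel) :=
      le_ciInf fun bs => aux_sqnorm_nonneg _
    rcases lt_trichotomy τ.card τ₀.card with hlt | heq | hgt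
    · have hN : sqnorm ((1 - projAug X τ urel).mulVec (X.mulVec β₀)) ≤
          ⨅ bs : (Fin p → ℝ) × ℝ,
            sqnorm (yobs - X.mulVec (maskOn τ bs.1) - bs.2 • urel) := by
        refine le_ciInf fun bs => ?_
        refine (aux_proj_le _ (hGramAug τ hlt) (X.mulVec β₀)
          (Sum.elim (fun k => bs.1 k.1) (fun _ => bs.2 - σ₀))).trans (le_of_eq ?_)
        rw [aux_aug, hy, sub_smul]
        congr 1
        abel
      have hN0 := aux_sqnorm_nonneg ((1 - projAug X τ urel).mulVec (X.mulVec β₀))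
      have hD0 := aux_sqnorm_nonneg ((1 - proj X τ).mulVec (X.mulVec β₀))
      have hS : 1 - gammaSq X τ₀ β₀ urel ≤
          sqnorm ((1 - projAug X τ urel).mulVec (X.mulVec β₀)) /
            sqnorm ((1 - proj X τ).mulVec (X.mulVec β₀)) := by
        rw [gammaSq, sub_sub_cancel]
        exact csInf_le (Set.toFinite _).bddBelow ⟨τ, hlt, rfl⟩
      have hS0 : 0 ≤ 1 - gammaSq X τ₀ β₀ urel := by
        rw [gammaSq, sub_sub_cancel]
        apply Real.sInf_nonneg
        rintro _ ⟨t, -, rfl⟩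
        exact div_nonneg (aux_sqnorm_nonneg _) (aux_sqnorm_nonneg _)
      have hC : Cmin X τ₀ β₀ ≤ sqnorm ((1 - proj X τ).mulVec (X.mulVec β₀)) /
        ((n * max (τ₀ \ τ).card 1 : ℕ) : ℝ) :=
        csInf_le (Set.toFinite _).bddBelow ⟨τ, ⟨hne, hlt.le⟩, rfl⟩
      generalize sqnorm ((1 - projAug X τ urel).mulVec (X.mulVec β₀)) = N at *
      generalize sqnorm ((1 - proj X τ).mulVec (X.mulVec β₀)) = D at *
      generalize 1 - gammaSq X τ₀ β₀ urel = S at *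
      generalize Cmin X τ₀ β₀ = C at *
      have hn : 0 < n := by
        rcases Nat.eq_zero_or_pos n with h | h
        · subst h
          simp at hlam₁
          linarith
        · exact h
      have hk1 : 1 ≤ max (τ₀ \ τ).card 1 := le_max_right _ _
      have hk2 : τ₀.card ≤ τ.card + max (τ₀ \ τ).card 1 := by
        have := Finset.le_card_sdiff τ τ₀
        have := le_max_left (τ₀ \ τ).card 1
        omega
      generalize max (τ₀ \ τ).card 1 = k at *
      have hk1' : (1 : ℝ) ≤ k := by exact_mod_cast hk1
      have hk2' : (τ₀.card : ℝ) ≤ τ.card + k := by exact_mod_cast hk2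
      have hn' : (0 : ℝ) < n := by exact_mod_cast hn
      push_cast at hC
      rw [le_div_iff₀ (by positivity)] at hC
      have hSD : S * D ≤ N := by
        rcases hD0.eq_or_lt with h | h
        · rw [← h, mul_zero]
          exact hN0
        · exact (le_div_iff₀ h).1 hS
      have e1 : S * (C * (n * k)) ≤ S * D := mul_le_mul_of_nonneg_left hC hS0
      have e2 : lam * k < n * S * C * k := mul_lt_mul_of_pos_right hlam₁ (by linarith)
      have e3 : lam * τ₀.card ≤ lam * (τ.card + k) := mul_le_mul_of_nonneg_left hk2' hlam₀.le
      nlinarith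
    · have := aux_pos X τ yobs urel (by
        intro β s hs
        rw [hy] at hs
        by_cases hσ : s = σ₀
        · subst hσ
          have := hid τ ⟨β, (add_right_cancel hs).symm⟩ hne
          omega
        · have hd : s - σ₀ ≠ 0 := sub_ne_zero.2 hσ
          apply hspan τ heq.le ((s - σ₀)⁻¹ • β₀) (-(s - σ₀)⁻¹ • β)
          have hm : ∀ (t : Finset (Fin p)) (c : ℝ) (b : Fin p → ℝ),
              maskOn t (c • b) = c • maskOn t b := by
            intro t c b
            ext j
            simp [maskOn]
          rw [hm, hm, hmask, Matrix.mulVec_smul, Matrix.mulVec_smul]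
          have h5 : (s - σ₀) • urel = X.mulVec β₀ - X.mulVec (maskOn τ β) := by
            rw [sub_smul, sub_eq_sub_iff_add_eq_add, add_comm, ← hs.symm, add_comm]
          rw [neg_smul, ← sub_eq_add_neg, ← smul_sub, ← h5, smul_smul, inv_mul_cancel₀ hd,
            one_smul])
      rw [heq]
      linarith
    · have : (τ₀.card : ℝ) < τ.card := by exact_mod_cast hgt
      have := mul_lt_mul_of_pos_left this hlam₀
      linarith
  have hle : ∀ τ : Finset (Fin p), objPen X lam yobs urel τ₀ ≤ objPen X lam yobs urel τ := by
    intro τ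
    by_cases h : τ = τ₀
    · rw [h]
    · exact (hstrict τ h).le
  refine ⟨⟨hle, hstrict⟩, fun τ β σ => ?_⟩
  have h1 := hle τ
  rw [hobj0, objPen] at h1
  have h2 := ciInf_le (hbdd τ) (β, σ)
  rw [hzero]
  simp only at h2
  linarith


end ReproSamples
end
end

section
/- Suppose the tuning parameter satisfies λ/n ∈ [6σ₀²(|τ₀|+1)log(p/2)/n + t, 0.05·C_min], where t > 0 is a positive constant. Then for any finite d, ℙ_{(𝒰^d,Y)}(τ₀ ∉ S^(d)) ≤ 6·exp[−(n/(18σ₀²))·(0.3·C_min − 36·(log(p+1)/n)·σ₀²)] + 3·exp(−n·t/(3σ₀²)) + exp{−n·d·(0.23 − (|τ₀|·log p + 2)/n)}. In particular, if |τ₀|·log p / n < 0.23 and C_min > 120·((|τ₀|+2)·log(p+1)/n)·σ₀² for n large enough, then ℙ_{(𝒰^d,Y)}(τ₀ ∉ S^(d)) → 0 as n → ∞ for any fixed d. -/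
open MeasureTheory ProbabilityTheory Matrix Filter
open scoped ENNReal Classical

noncomputable section

namespace ReproSamples

abbrev Eu (n : ℕ) := EuclideanSpace ℝ (Fin n)

abbrev toE {n : ℕ} (u : Fin n → ℝ) : Eu n := WithLp.toLp 2 u

instance stdG_prob (n : ℕ) : IsProbabilityMeasure (stdGaussian n) := by
  unfold stdGaussian; infer_instance

lemma gauss1d (c w : ℝ) (hc : 2 * c < 1) :
    ∫⁻ x, ENNReal.ofReal (Real.exp (c * x ^ 2 + w * x)) ∂(gaussianReal 0 1) =
      ENNReal.ofReal ((Real.sqrt (1 - 2 * c))⁻¹ * Real.exp (w ^ 2 / (2 * (1 - 2 * c)))) := by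
  have hpos : 0 < 1 - 2 * c := by linarith
  set v : NNReal := ⟨(1 - 2 * c)⁻¹, by positivity⟩ with hv
  have hvc : (v : ℝ) = (1 - 2 * c)⁻¹ := rfl
  have hv0 : v ≠ 0 := by
    intro h
    have : (v : ℝ) = 0 := by rw [h]; rfl
    rw [hvc] at this
    have := inv_pos.mpr hpos
    linarith
  rw [gaussianReal_of_var_ne_zero 0 one_ne_zero,
    lintegral_withDensity_eq_lintegral_mul _ (measurable_gaussianPDF _ _) (by fun_prop)]
  have key : ∀ x : ℝ, (gaussianPDF 0 1 * fun x => ENNReal.ofReal (Real.exp (c * x ^ 2 + w * x))) x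
      = ENNReal.ofReal ((Real.sqrt (1 - 2 * c))⁻¹ * Real.exp (w ^ 2 / (2 * (1 - 2 * c)))) *
        gaussianPDF (w * v) v x := by
    intro x
    simp only [Pi.mul_apply, gaussianPDF]
    rw [← ENNReal.ofReal_mul (gaussianPDFReal_nonneg _ _ _), ← ENNReal.ofReal_mul (by positivity)]
    congr 1
    simp only [gaussianPDFReal, hvc, NNReal.coe_one]
    rw [show 2 * Real.pi * (1 - 2 * c)⁻¹ = (2 * Real.pi) * (1 - 2 * c)⁻¹ by ring,
      Real.sqrt_mul (by positivity) (1 - 2 * c)⁻¹, Real.sqrt_inv, mul_inv, inv_inv, mul_one]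
    have hs : Real.sqrt (1 - 2 * c) ≠ 0 := (Real.sqrt_pos.mpr hpos).ne'
    rw [mul_assoc, ← Real.exp_add]
    rw [show (√(1 - 2 * c))⁻¹ * Real.exp (w ^ 2 / (2 * (1 - 2 * c))) *
      ((√(2 * Real.pi))⁻¹ * √(1 - 2 * c) * Real.exp (-(x - w * (1 - 2 * c)⁻¹) ^ 2 / (2 * (1 - 2 * c)⁻¹)))
      = ((√(1 - 2 * c))⁻¹ * √(1 - 2 * c)) * ((√(2 * Real.pi))⁻¹ * (Real.exp (w ^ 2 / (2 * (1 - 2 * c))) *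
      Real.exp (-(x - w * (1 - 2 * c)⁻¹) ^ 2 / (2 * (1 - 2 * c)⁻¹)))) by ring, inv_mul_cancel₀ hs,
      one_mul, ← Real.exp_add]
    congr 2
    field_simp
    ring
  rw [lintegral_congr key, lintegral_const_mul _ (measurable_gaussianPDF _ _),
    lintegral_gaussianPDF_eq_one _ hv0, mul_one]

lemma lint_pi_prod {ι : Type} [Fintype ι] (f : ι → ℝ → ℝ≥0∞) (hf : ∀ i, Measurable (f i)) :
    ∫⁻ g : ι → ℝ, ∏ i, f i (g i) ∂(Measure.pi fun _ => gaussianReal 0 1) =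
      ∏ i, ∫⁻ x, f i x ∂(gaussianReal 0 1) := by
  have h0 := lintegral_prod_eq_prod_lintegral_of_indepFun
    (μ := (Measure.pi fun _ : ι => gaussianReal 0 1)) Finset.univ
    (fun i (g : ι → ℝ) => f i (g i))
    (iIndepFun_pi (fun i => (hf i).aemeasurable))
    (fun i => (hf i).comp (measurable_pi_apply i))
  rw [h0]
  refine Finset.prod_congr rfl fun i _ => ?_
  exact (measurePreserving_eval (fun _ : ι => gaussianReal 0 1) i).lintegral_comp (hf i)

lemma norm_toE {n : ℕ} (u : Fin n → ℝ) : ‖toE u‖ ^ 2 = ∑ i, (u i) ^ 2 := by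
  rw [EuclideanSpace.norm_sq_eq]; simp

lemma gauss_quad {n : ℕ} (b : ℝ) (hb : 0 < 1 + 2 * b) (w : Eu n) :
    ∫⁻ u, ENNReal.ofReal (Real.exp (-b * ‖toE u‖ ^ 2 + inner ℝ w (toE u))) ∂(stdGaussian n) =
      ENNReal.ofReal ((Real.sqrt (1 + 2 * b))⁻¹ ^ n * Real.exp (‖w‖ ^ 2 / (2 * (1 + 2 * b)))) := by
  have h1 : ∀ u : Fin n → ℝ, ENNReal.ofReal (Real.exp (-b * ‖toE u‖ ^ 2 + inner ℝ w (toE u))) =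
      ∏ i, ENNReal.ofReal (Real.exp (-b * (u i) ^ 2 + w i * u i)) := by
    intro u
    rw [← ENNReal.ofReal_prod_of_nonneg (fun i _ => (Real.exp_pos _).le), ← Real.exp_sum]
    congr 2
    rw [norm_toE, Finset.sum_add_distrib, Finset.mul_sum]
    congr 1
    simp [PiLp.inner_apply, mul_comm]
  rw [lintegral_congr h1, stdGaussian,
    lint_pi_prod (fun i x => ENNReal.ofReal (Real.exp (-b * x ^ 2 + w i * x)))
      (fun i => by fun_prop)]
  simp_rw [gauss1d (-b) _ (by linarith : 2 * (-b) < 1)]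
  rw [← ENNReal.ofReal_prod_of_nonneg (fun i _ => by positivity), Finset.prod_mul_distrib,
    ← Real.exp_sum]
  congr 2
  · simp
  · congr 1
    rw [EuclideanSpace.norm_sq_eq, Finset.sum_div]
    simp

lemma master {n : ℕ} {ι : Type} [Fintype ι] (e : ι → Eu n) (he : Orthonormal ℝ e)
    (v : Eu n) (hv : ∀ i, inner ℝ v (e i) = 0) (b : ℝ) (hb : 0 < 1 + 2 * b)
    (a : ι → ℝ) (ha : ∀ i, 0 ≤ a i) (ha' : ∀ i, 2 * a i < 1 + 2 * b) :
    ∫⁻ u, ENNReal.ofReal (Real.exp (-b * ‖toE u‖ ^ 2 + ∑ i, a i * (inner ℝ (e i) (toE u)) ^ 2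
        + inner ℝ v (toE u))) ∂(stdGaussian n) =
      ENNReal.ofReal ((Real.sqrt (1 + 2 * b))⁻¹ ^ n *
        (∏ i, (Real.sqrt (1 - 2 * (a i / (1 + 2 * b))))⁻¹) *
          Real.exp (‖v‖ ^ 2 / (2 * (1 + 2 * b)))) := by
  set γ : Measure (ι → ℝ) := Measure.pi fun _ => gaussianReal 0 1 with hγ
  set W : (ι → ℝ) → Eu n := fun g => v + ∑ i, (Real.sqrt (2 * a i) * g i) • e i with hW
  have hWc : Continuous W := by fun_prop
  have hWn : ∀ g, ‖W g‖ ^ 2 = ‖v‖ ^ 2 + ∑ i, 2 * a i * g i ^ 2 := by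
    intro g
    have h1 : inner ℝ v (∑ i, (Real.sqrt (2 * a i) * g i) • e i) = 0 := by
      rw [inner_sum]
      refine Finset.sum_eq_zero fun i _ => ?_
      rw [inner_smul_right, hv, mul_zero]
    have h2 : ‖∑ i, (Real.sqrt (2 * a i) * g i) • e i‖ ^ 2 = ∑ i, 2 * a i * g i ^ 2 := by
      rw [← real_inner_self_eq_norm_sq, he.inner_sum]
      refine Finset.sum_congr rfl fun i _ => ?_
      have : Real.sqrt (2 * a i) * Real.sqrt (2 * a i) = 2 * a i :=
        Real.mul_self_sqrt (by have := ha i; linarith)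
      simp only [conj_trivial]
      linear_combination (g i) ^ 2 * this
    rw [hW]; simp only
    rw [norm_add_sq_real, h1, h2]; ring
  have h1 : ∀ u : Fin n → ℝ, ENNReal.ofReal (Real.exp (-b * ‖toE u‖ ^ 2 +
      ∑ i, a i * (inner ℝ (e i) (toE u)) ^ 2 + inner ℝ v (toE u))) =
      ∫⁻ g, ENNReal.ofReal (Real.exp (-b * ‖toE u‖ ^ 2 + inner ℝ (W g) (toE u))) ∂γ := by
    intro u
    have h3 : ∀ g : ι → ℝ, ENNReal.ofReal (Real.exp (-b * ‖toE u‖ ^ 2 + inner ℝ (W g) (toE u))) =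
        ENNReal.ofReal (Real.exp (-b * ‖toE u‖ ^ 2 + inner ℝ v (toE u))) *
        ∏ i, ENNReal.ofReal (Real.exp (0 * (g i) ^ 2 +
          (Real.sqrt (2 * a i) * inner ℝ (e i) (toE u)) * g i)) := by
      intro g
      rw [← ENNReal.ofReal_prod_of_nonneg (fun i _ => (Real.exp_pos _).le), ← Real.exp_sum,
        ← ENNReal.ofReal_mul (Real.exp_pos _).le, ← Real.exp_add]
      congr 2
      rw [hW]; simp only
      rw [inner_add_left, sum_inner, ← add_assoc]
      congr 1
      refine Finset.sum_congr rfl fun i _ => ?_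
      rw [real_inner_smul_left]; ring
    rw [lintegral_congr h3, lintegral_const_mul _ (by fun_prop), hγ,
      lint_pi_prod (fun i x => ENNReal.ofReal (Real.exp (0 * x ^ 2 +
          (Real.sqrt (2 * a i) * inner ℝ (e i) (toE u)) * x))) (fun i => by fun_prop)]
    simp_rw [gauss1d 0 _ (by norm_num : 2 * (0:ℝ) < 1)]
    rw [← ENNReal.ofReal_prod_of_nonneg (fun i _ => by positivity), Finset.prod_mul_distrib,
      ← Real.exp_sum, ← ENNReal.ofReal_mul (Real.exp_pos _).le]
    simp only [mul_zero, sub_zero, Real.sqrt_one, inv_one, Finset.prod_const_one, one_mul, mul_one]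
    rw [← Real.exp_add]
    congr 2
    have : ∀ i, (Real.sqrt (2 * a i) * inner ℝ (e i) (toE u)) ^ 2 / 2 =
        a i * (inner ℝ (e i) (toE u)) ^ 2 := by
      intro i
      rw [mul_pow, Real.sq_sqrt (by have := ha i; linarith)]; ring
    simp_rw [this]; ring
  rw [lintegral_congr h1, lintegral_lintegral_swap]
  swap
  · apply Measurable.aemeasurable
    apply Continuous.measurable
    have : Continuous (fun q : (Fin n → ℝ) × (ι → ℝ) => toE q.1) := by fun_prop
    unfold Function.uncurry
    refine ENNReal.continuous_ofReal.comp ?_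
    fun_prop
  simp_rw [gauss_quad b hb, hWn]
  have h4 : ∀ g : ι → ℝ, ENNReal.ofReal ((Real.sqrt (1 + 2 * b))⁻¹ ^ n *
      Real.exp ((‖v‖ ^ 2 + ∑ i, 2 * a i * g i ^ 2) / (2 * (1 + 2 * b)))) =
      ENNReal.ofReal ((Real.sqrt (1 + 2 * b))⁻¹ ^ n * Real.exp (‖v‖ ^ 2 / (2 * (1 + 2 * b)))) *
      ∏ i, ENNReal.ofReal (Real.exp ((a i / (1 + 2 * b)) * (g i) ^ 2 + 0 * g i)) := by
    intro g
    rw [← ENNReal.ofReal_prod_of_nonneg (fun i _ => (Real.exp_pos _).le), ← Real.exp_sum,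
        ← ENNReal.ofReal_mul (by positivity), mul_assoc, ← Real.exp_add]
    congr 3
    rw [add_div, Finset.sum_div]
    congr 1
    refine Finset.sum_congr rfl fun i _ => ?_
    field_simp
    ring
  have h5 : ∀ i, 2 * (a i / (1 + 2 * b)) < 1 := by
    intro i
    rw [← mul_div_assoc, div_lt_one hb]; exact ha' i
  rw [lintegral_congr h4, lintegral_const_mul _ (by fun_prop), hγ,
      lint_pi_prod (fun i x => ENNReal.ofReal (Real.exp ((a i / (1 + 2 * b)) * x ^ 2 + 0 * x)))
        (fun i => by fun_prop)]
  simp_rw [fun i => gauss1d (a i / (1 + 2 * b)) 0 (h5 i)]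
  rw [← ENNReal.ofReal_prod_of_nonneg (fun i _ => by positivity), ← ENNReal.ofReal_mul (by positivity)]
  congr 1
  simp
  ring

lemma chernoff {n : ℕ} (f : (Fin n → ℝ) → ℝ) (hf : Continuous f) (S : Set (Fin n → ℝ))
    (hS : ∀ u ∈ S, 0 ≤ f u) :
    stdGaussian n S ≤ ∫⁻ u, ENNReal.ofReal (Real.exp (f u)) ∂(stdGaussian n) := by
  have h := mul_meas_ge_le_lintegral (μ := stdGaussian n)
    (f := fun u => ENNReal.ofReal (Real.exp (f u))) (by fun_prop) 1
  rw [one_mul] at h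
  refine le_trans (measure_mono fun u hu => ?_) h
  simp only [Set.mem_ofPred_eq]
  rw [← ENNReal.ofReal_one]
  exact ENNReal.ofReal_le_ofReal (Real.one_le_exp (hS u hu))


abbrev PW {n : ℕ} (W : Submodule ℝ (Eu n)) (x : Eu n) : Eu n := W.starProjection x

lemma inner_PW {n : ℕ} (W : Submodule ℝ (Eu n)) (x w : Eu n) (hw : w ∈ W) :
    inner ℝ w (PW W x) = inner ℝ w x := by
  have h := Submodule.starProjection_inner_eq_zero (K := W) x w hw
  rw [real_inner_comm, inner_sub_right] at h
  linarith

lemma PW_mem {n : ℕ} (W : Submodule ℝ (Eu n)) (x : Eu n) : PW W x ∈ W :=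
  Submodule.starProjection_apply_mem W x

lemma res_sq {n : ℕ} (W : Submodule ℝ (Eu n)) (x : Eu n) :
    ‖x - PW W x‖ ^ 2 = ‖x‖ ^ 2 - ‖PW W x‖ ^ 2 := by
  have h := inner_PW W x (PW W x) (PW_mem W x)
  rw [norm_sub_sq_real, real_inner_comm, ← h, real_inner_self_eq_norm_sq]; ring

lemma res_min {n : ℕ} (W : Submodule ℝ (Eu n)) (x w : Eu n) (hw : w ∈ W) :
    ‖x - PW W x‖ ^ 2 ≤ ‖x - w‖ ^ 2 := by
  have h1 := inner_PW W x w hw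
  have h2 := inner_PW W x (PW W x) (PW_mem W x)
  rw [res_sq, norm_sub_sq_real, real_inner_comm, ← h1]
  have h3 := norm_sub_sq_real (PW W x) w
  have h4 := sq_nonneg ‖PW W x - w‖
  rw [real_inner_comm] at h3
  linarith

lemma PW_mono {n : ℕ} (W' W : Submodule ℝ (Eu n)) (h : W' ≤ W) (x : Eu n) :
    ‖PW W' x‖ ^ 2 ≤ ‖PW W x‖ ^ 2 := by
  have h1 := res_min W x (PW W' x) (h (PW_mem _ _))
  rw [res_sq, res_sq] at h1; linarith

lemma diffproj {n : ℕ} (W' W : Submodule ℝ (Eu n)) (h : W' ≤ W) (m : ℕ)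
    (hm : Module.finrank ℝ W ≤ Module.finrank ℝ W' + m) :
    ∃ k ≤ m, ∃ e : Fin k → Eu n, Orthonormal ℝ e ∧ (∀ i, e i ∈ W) ∧
      ∀ x, ‖PW W x‖ ^ 2 - ‖PW W' x‖ ^ 2 = ∑ i, (inner ℝ (e i) x) ^ 2 := by
  set K : Submodule ℝ (Eu n) := W'ᗮ ⊓ W with hK
  have hd := Submodule.finrank_add_inf_finrank_orthogonal h
  rw [← hK] at hd
  let b := stdOrthonormalBasis ℝ K
  refine ⟨Module.finrank ℝ K, by omega, fun i => (b i : Eu n), ?_, fun i => (b i).2.2, ?_⟩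
  · exact b.orthonormal.comp_linearIsometry K.subtypeₗᵢ
  · intro x
    have hz : PW W x - PW W' x ∈ K := by
      refine ⟨?_, W.sub_mem (PW_mem _ _) (h (PW_mem _ _))⟩
      rw [SetLike.mem_coe, Submodule.mem_orthogonal]
      intro w hw
      rw [inner_sub_right, inner_PW W x w (h hw), inner_PW W' x w hw, sub_self]
    have h0 : inner ℝ (PW W' x) (PW W x - PW W' x) = 0 :=
      (Submodule.mem_orthogonal _ _).1 hz.1 _ (PW_mem _ _)
    have h1 : ‖PW W x‖ ^ 2 = ‖PW W' x‖ ^ 2 + ‖PW W x - PW W' x‖ ^ 2 := by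
      have := norm_add_sq_real (PW W' x) (PW W x - PW W' x)
      rw [h0, add_sub_cancel] at this
      linarith
    have h2 : ‖PW W x - PW W' x‖ ^ 2 = ∑ i, (inner ℝ (b i : Eu n) x) ^ 2 := by
      have h3 := b.sum_sq_norm_inner_right ⟨_, hz⟩
      have h4 : ‖(⟨_, hz⟩ : K)‖ = ‖PW W x - PW W' x‖ := rfl
      rw [← h4, ← h3]
      refine Finset.sum_congr rfl fun i _ => ?_
      rw [Submodule.coe_inner, Real.norm_eq_abs, sq_abs]
      congr 1
      show inner ℝ (b i : Eu n) (PW W x - PW W' x) = _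
      rw [inner_sub_right, inner_PW W x _ (b i).2.2,
        Submodule.inner_left_of_mem_orthogonal (PW_mem W' x) (b i).2.1, sub_zero]
    rw [h1, ← h2]; ring

lemma PW_expand {n : ℕ} (V : Submodule ℝ (Eu n)) (m : ℕ) (hm : Module.finrank ℝ V ≤ m) :
    ∃ k ≤ m, ∃ e : Fin k → Eu n, Orthonormal ℝ e ∧ (∀ i, e i ∈ V) ∧
      ∀ x, ‖PW V x‖ ^ 2 = ∑ i, (inner ℝ (e i) x) ^ 2 := by
  obtain ⟨k, hk, e, h1, h2, h3⟩ := diffproj ⊥ V bot_le m (by simpa using hm)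
  refine ⟨k, hk, e, h1, h2, fun x => ?_⟩
  rw [← h3 x]
  simp [PW]

def Vs {n p : ℕ} (X : Matrix (Fin n) (Fin p) ℝ) (τ : Finset (Fin p)) : Submodule ℝ (Eu n) :=
  Submodule.span ℝ ((fun j => toE (fun i => X i j)) '' (τ : Set (Fin p)))

def Ws {n p : ℕ} (X : Matrix (Fin n) (Fin p) ℝ) (u : Fin n → ℝ) (τ : Finset (Fin p)) :
    Submodule ℝ (Eu n) :=
  Vs X τ ⊔ Submodule.span ℝ {toE u}

lemma mulVec_mask {n p : ℕ} (X : Matrix (Fin n) (Fin p) ℝ) (τ : Finset (Fin p))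
    (β : Fin p → ℝ) :
    toE (X.mulVec (maskOn τ β)) = ∑ j ∈ τ, β j • toE (fun i => X i j) := by
  ext i
  simp only [maskOn, Matrix.mulVec, dotProduct, mul_ite, mul_zero, Finset.sum_ite_mem,
    Finset.univ_inter]
  simp [mul_comm]

lemma mask_mem {n p : ℕ} (X : Matrix (Fin n) (Fin p) ℝ) (τ : Finset (Fin p))
    (β : Fin p → ℝ) : toE (X.mulVec (maskOn τ β)) ∈ Vs X τ := by
  rw [mulVec_mask]
  exact Submodule.sum_mem _ fun j hj => Submodule.smul_mem _ _
    (Submodule.subset_span ⟨j, hj, rfl⟩)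

lemma mem_Vs {n p : ℕ} (X : Matrix (Fin n) (Fin p) ℝ) (τ : Finset (Fin p)) (x : Eu n)
    (hx : x ∈ Vs X τ) : ∃ β : Fin p → ℝ, toE (X.mulVec (maskOn τ β)) = x := by
  unfold Vs at hx
  rw [Submodule.mem_span_image_finset_iff_exists_fun] at hx
  obtain ⟨c, hc⟩ := hx
  refine ⟨fun j => if h : j ∈ τ then c ⟨j, h⟩ else 0, ?_⟩
  rw [mulVec_mask, ← hc, ← Finset.sum_coe_sort τ]
  refine Finset.sum_congr rfl fun j _ => ?_
  simp

lemma Vs_mono {n p : ℕ} (X : Matrix (Fin n) (Fin p) ℝ) {τ τ' : Finset (Fin p)} (h : τ ⊆ τ') :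
    Vs X τ ≤ Vs X τ' := Submodule.span_mono (Set.image_mono (by exact_mod_cast h))

lemma Ws_mono {n p : ℕ} (X : Matrix (Fin n) (Fin p) ℝ) (u : Fin n → ℝ)
    {τ τ' : Finset (Fin p)} (h : τ ⊆ τ') :
    Ws X u τ ≤ Ws X u τ' := sup_le_sup_right (Vs_mono X h) _

lemma Vs_finrank {n p : ℕ} (X : Matrix (Fin n) (Fin p) ℝ) (τ : Finset (Fin p)) :
    Module.finrank ℝ (Vs X τ) ≤ τ.card := by
  unfold Vs
  rw [← Finset.coe_image]
  exact (finrank_span_finset_le_card _).trans Finset.card_image_le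

lemma Ws_finrank {n p : ℕ} (X : Matrix (Fin n) (Fin p) ℝ) (u : Fin n → ℝ)
    (τ τ' : Finset (Fin p)) :
    Module.finrank ℝ (Ws X u (τ ∪ τ')) ≤ Module.finrank ℝ (Ws X u τ) + τ'.card := by
  have h : Ws X u (τ ∪ τ') = Ws X u τ ⊔ Vs X τ' := by
    unfold Ws Vs
    rw [Finset.coe_union, Set.image_union, Submodule.span_union, sup_right_comm]
  rw [h]
  exact (Submodule.finrank_add_le_finrank_add_finrank _ _).trans
    (Nat.add_le_add_left (Vs_finrank X τ') _)

lemma sqnorm_eq {n : ℕ} (u : Fin n → ℝ) : sqnorm u = ‖toE u‖ ^ 2 := by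
  rw [norm_toE]; rfl

lemma objPen_eq {n p : ℕ} (X : Matrix (Fin n) (Fin p) ℝ) (lam : ℝ) (y u : Fin n → ℝ)
    (τ : Finset (Fin p)) :
    objPen X lam y u τ = ‖toE y - PW (Ws X u τ) (toE y)‖ ^ 2 + lam * τ.card := by
  unfold objPen
  congr 1
  have hsq : ∀ bs : (Fin p → ℝ) × ℝ, sqnorm (y - X.mulVec (maskOn τ bs.1) - bs.2 • u) =
      ‖toE y - (toE (X.mulVec (maskOn τ bs.1)) + bs.2 • toE u)‖ ^ 2 := by
    intro bs
    rw [sqnorm_eq]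
    congr 2
    simp only [toE, WithLp.toLp_sub, WithLp.toLp_smul]
    abel
  apply le_antisymm
  · have hm := PW_mem (Ws X u τ) (toE y)
    obtain ⟨x, hx, z, hz, hxz⟩ := Submodule.mem_sup.1 hm
    obtain ⟨β, hβ⟩ := mem_Vs X τ x hx
    obtain ⟨c, hc⟩ := Submodule.mem_span_singleton.1 hz
    refine (ciInf_le ⟨0, ?_⟩ (β, c)).trans ?_
    · rintro _ ⟨bs, rfl⟩
      simp only [hsq]; positivity
    · rw [hsq]; simp only
      rw [hβ, hc, hxz]
  · refine le_ciInf fun bs => ?_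
    rw [hsq]
    refine res_min _ _ _ (Submodule.add_mem_sup (mask_mem _ _ _) ?_)
    exact Submodule.smul_mem _ _ (Submodule.mem_span_singleton_self _)

lemma proj_eq {n p : ℕ} (X : Matrix (Fin n) (Fin p) ℝ) (τ : Finset (Fin p))
    (hG : IsUnit ((subcols X τ)ᵀ * subcols X τ).det) (μ : Fin n → ℝ) :
    sqnorm ((1 - proj X τ).mulVec μ) = ‖toE μ - PW (Vs X τ) (toE μ)‖ ^ 2 := by
  rw [sqnorm_eq]
  congr 2
  rw [Matrix.sub_mulVec, Matrix.one_mulVec]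
  show toE μ - toE ((proj X τ).mulVec μ) = _
  congr 1
  set M := subcols X τ with hM
  have horth : Mᵀ.mulVec (μ - (proj X τ).mulVec μ) = 0 := by
    rw [Matrix.mulVec_sub, Matrix.mulVec_mulVec]
    have : Mᵀ * proj X τ = Mᵀ := by
      unfold proj projMat
      rw [← hM, ← Matrix.mul_assoc, ← Matrix.mul_assoc, Matrix.mul_nonsing_inv _ hG,
        Matrix.one_mul]
    rw [this, sub_self]
  symm
  apply Submodule.eq_starProjection_of_mem_orthogonal
  · have h1 : (proj X τ).mulVec μ = M.mulVec (((Mᵀ * M)⁻¹ * Mᵀ).mulVec μ) := by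
      rw [Matrix.mulVec_mulVec, ← Matrix.mul_assoc]; rfl
    rw [h1]
    set g := ((Mᵀ * M)⁻¹ * Mᵀ).mulVec μ
    have h2 : toE (M.mulVec g) = ∑ j : {j // j ∈ τ}, g j • toE (fun i => X i j.1) := by
      ext i
      simp [Matrix.mulVec, dotProduct, hM, subcols, mul_comm]
    rw [h2]
    exact Submodule.sum_mem _ fun j _ => Submodule.smul_mem _ _
      (Submodule.subset_span ⟨j.1, j.2, rfl⟩)
  · rw [Submodule.mem_orthogonal]
    intro x hx
    unfold Vs at hx
    induction hx using Submodule.span_induction with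
    | mem x hx =>
      obtain ⟨j, hj, rfl⟩ := hx
      have h3 := congrFun horth ⟨j, hj⟩
      simp only [Matrix.mulVec, dotProduct, Matrix.transpose_apply, hM, subcols, Matrix.of_apply,
        Pi.zero_apply] at h3
      rw [← h3]
      simp [PiLp.inner_apply, mul_comm, Matrix.mulVec, dotProduct]
    | zero => simp
    | add x y _ _ hx hy => rw [inner_add_left, hx, hy, add_zero]
    | smul a x _ hx => rw [real_inner_smul_left, hx, mul_zero]

lemma Cmin_le {n p : ℕ} (X : Matrix (Fin n) (Fin p) ℝ) (τ₀ : Finset (Fin p)) (β₀ : Fin p → ℝ)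
    (hn : 0 < n) (τ : Finset (Fin p)) (hτ : τ ≠ τ₀) (hc : τ.card ≤ τ₀.card)
    (hG : IsUnit ((subcols X τ)ᵀ * subcols X τ).det) :
    (n : ℝ) * ((τ₀ \ τ).card : ℝ) * Cmin X τ₀ β₀ ≤
      ‖toE (X.mulVec β₀) - PW (Vs X τ) (toE (X.mulVec β₀))‖ ^ 2 := by
  rw [← proj_eq X τ hG]
  have hj : 1 ≤ (τ₀ \ τ).card := by
    rw [Nat.one_le_iff_ne_zero, Ne, Finset.card_eq_zero, Finset.sdiff_eq_empty_iff_subset]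
    intro h
    exact hτ (Finset.eq_of_subset_of_card_le h hc).symm
  have h := csInf_le (s := ((fun τ : Finset (Fin p) =>
      sqnorm ((1 - proj X τ).mulVec (X.mulVec β₀)) /
        ((n * max (τ₀ \ τ).card 1 : ℕ) : ℝ)) ''
    {τ : Finset (Fin p) | τ ≠ τ₀ ∧ τ.card ≤ τ₀.card})) (Set.Finite.bddBelow (Set.toFinite _))
    ⟨τ, ⟨hτ, hc⟩, rfl⟩
  change Cmin X τ₀ β₀ ≤ _ at h
  simp only [max_eq_left hj] at h
  have hpos : (0 : ℝ) < ((n * (τ₀ \ τ).card : ℕ) : ℝ) := by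
    have := Nat.mul_pos hn hj
    exact_mod_cast this
  rw [le_div_iff₀ hpos] at h
  push_cast at h
  linarith


lemma res_expand {n : ℕ} (W : Submodule ℝ (Eu n)) (M x : Eu n) (σ : ℝ) :
    ‖(M + σ • x) - PW W (M + σ • x)‖ ^ 2 =
      ‖M - PW W M‖ ^ 2 + 2 * σ * inner ℝ (M - PW W M) x + σ ^ 2 * (‖x‖ ^ 2 - ‖PW W x‖ ^ 2) := by
  have h0 : inner ℝ (M - PW W M) (PW W x) = 0 :=
    Submodule.starProjection_inner_eq_zero (K := W) M _ (PW_mem W x)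
  have h1 : (M + σ • x) - PW W (M + σ • x) = (M - PW W M) + σ • (x - PW W x) := by
    simp only [PW, map_add, map_smul, smul_sub]; abel
  rw [h1, norm_add_sq_real, norm_smul, mul_pow, res_sq W x, inner_smul_right, inner_sub_right, h0,
    Real.norm_eq_abs, sq_abs]
  ring

lemma res_zero {n : ℕ} (W : Submodule ℝ (Eu n)) (M : Eu n) (h : M ∈ W) : M - PW W M = 0 := by
  rw [sub_eq_zero]; exact (Submodule.starProjection_eq_self_iff.2 h).symm

lemma under_prob {n p : ℕ} (X : Matrix (Fin n) (Fin p) ℝ) (τ₀ : Finset (Fin p)) (μ : Fin n → ℝ)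
    (hμ : toE μ ∈ Vs X τ₀) (σ : ℝ) (hσ : 0 < σ) (lam : ℝ) (u : Fin n → ℝ) (τ : Finset (Fin p))
    (D₀ L : ℝ) (hD : D₀ ≤ ‖toE μ - PW (Ws X u τ) (toE μ)‖ ^ 2)
    (hL : lam * (τ₀.card - τ.card : ℝ) ≤ L) :
    stdGaussian n {U | objPen X lam (μ + σ • U) u τ ≤ objPen X lam (μ + σ • U) u τ₀} ≤
      ENNReal.ofReal (Real.sqrt 2 ^ (τ \ τ₀).card * Real.exp (-(D₀ / 8 - L / 4) / σ ^ 2)) := by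
  set M := toE μ with hM
  set W := Ws X u τ with hW
  set r := M - PW W M with hr
  have hrW : ∀ w ∈ W, inner ℝ r w = 0 := fun w hw =>
    Submodule.starProjection_inner_eq_zero (K := W) M _ hw
  obtain ⟨k, hk, e, he, heW, hex⟩ := diffproj (Ws X u (τ ∩ τ₀)) W (Ws_mono X u Finset.inter_subset_left)
    (τ \ τ₀).card (by
      have := Ws_finrank X u (τ ∩ τ₀) (τ \ τ₀)
      rwa [show τ ∩ τ₀ ∪ τ \ τ₀ = τ by ext x; simp only [Finset.mem_union, Finset.mem_inter, Finset.mem_sdiff]; tauto] at this)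
  set v : Eu n := (-(1 / (2 * σ))) • r with hv
  refine (chernoff (fun U => (-0 * ‖toE U‖ ^ 2 + ∑ i, (1 / 4 : ℝ) * (inner ℝ (e i) (toE U)) ^ 2
      + inner ℝ v (toE U)) + (-(‖r‖ ^ 2 - L) / (4 * σ ^ 2))) (by fun_prop) _ ?_).trans ?_
  · intro U hU
    have hU' : objPen X lam (μ + σ • U) u τ ≤ objPen X lam (μ + σ • U) u τ₀ := hU
    rw [objPen_eq, objPen_eq] at hU'
    have hy : toE (μ + σ • U) = M + σ • toE U := by
      simp [hM, toE, WithLp.toLp_add, WithLp.toLp_smul]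
    rw [hy, res_expand, res_expand, res_zero (Ws X u τ₀) M (le_sup_left (a := Vs X τ₀) hμ)] at hU'
    have h1 := PW_mono (Ws X u (τ ∩ τ₀)) (Ws X u τ₀) (Ws_mono X u Finset.inter_subset_right) (toE U)
    have h2 := hex (toE U)
    rw [inner_zero_left, norm_zero] at hU'
    change ‖r‖ ^ 2 + 2 * σ * inner ℝ r (toE U) + _ + _ ≤ _ at hU'
    have hs2 : 0 < σ ^ 2 := by positivity
    have h3 : 0 ≤ σ ^ 2 * (‖PW W (toE U)‖ ^ 2 - ‖PW (Ws X u (τ ∩ τ₀)) (toE U)‖ ^ 2) -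
        ‖r‖ ^ 2 - 2 * σ * inner ℝ r (toE U) + L := by
      have := mul_le_mul_of_nonneg_left h1 hs2.le
      nlinarith
    rw [h2] at h3
    rw [← Finset.mul_sum, hv, real_inner_smul_left]
    have : (-0 * ‖toE U‖ ^ 2 + 1 / 4 * ∑ i, inner ℝ (e i) (toE U) ^ 2 + -(1 / (2 * σ)) * inner ℝ r (toE U) +
      -(‖r‖ ^ 2 - L) / (4 * σ ^ 2)) = (σ ^ 2 * (∑ i, inner ℝ (e i) (toE U) ^ 2) -
        ‖r‖ ^ 2 - 2 * σ * inner ℝ r (toE U) + L) / (4 * σ ^ 2) := by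
      field_simp
      ring
    rw [this]
    positivity
  · have h1 : ∀ U : Fin n → ℝ, ENNReal.ofReal (Real.exp ((-0 * ‖toE U‖ ^ 2 +
        ∑ i, (1 / 4 : ℝ) * (inner ℝ (e i) (toE U)) ^ 2
        + inner ℝ v (toE U)) + (-(‖r‖ ^ 2 - L) / (4 * σ ^ 2)))) =
        ENNReal.ofReal (Real.exp (-0 * ‖toE U‖ ^ 2 +
        ∑ i, (1 / 4 : ℝ) * (inner ℝ (e i) (toE U)) ^ 2
        + inner ℝ v (toE U))) * ENNReal.ofReal (Real.exp (-(‖r‖ ^ 2 - L) / (4 * σ ^ 2))) := by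
      intro U
      rw [Real.exp_add _ (-(‖r‖ ^ 2 - L) / (4 * σ ^ 2)), ENNReal.ofReal_mul (Real.exp_pos _).le]
    rw [lintegral_congr h1, lintegral_mul_const _ (by fun_prop),
      master e he v (fun i => by rw [hv, real_inner_smul_left, hrW _ (heW i), mul_zero]) 0
        (by norm_num) (fun _ => 1 / 4) (fun _ => by norm_num) (fun _ => by norm_num),
      ← ENNReal.ofReal_mul (by positivity)]
    apply ENNReal.ofReal_le_ofReal
    have h2 : (Real.sqrt (1 - 2 * (1 / 4 / (1 + 2 * 0))))⁻¹ = Real.sqrt 2 := by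
      rw [← Real.sqrt_inv]; norm_num
    have h3 : ‖v‖ ^ 2 = ‖r‖ ^ 2 / (4 * σ ^ 2) := by
      rw [hv, norm_smul, mul_pow, Real.norm_eq_abs, sq_abs]; field_simp; ring
    simp only [h2, h3, Finset.prod_const, Finset.card_univ, Fintype.card_fin]
    simp only [mul_zero, add_zero,
      Real.sqrt_one, inv_one, one_pow, one_mul]
    rw [mul_assoc, ← Real.exp_add]
    apply mul_le_mul _ _ (Real.exp_pos _).le (by positivity)
    · exact pow_le_pow_right₀ (Real.one_le_sqrt.2 (by norm_num)) hk
    · apply Real.exp_le_exp.2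
      have : ‖r‖ ^ 2 / (4 * σ ^ 2) / (2 * 1) + -(‖r‖ ^ 2 - L) / (4 * σ ^ 2) =
        -(‖r‖ ^ 2 / 8 - L / 4) / σ ^ 2 := by field_simp; ring
      rw [this]
      apply div_le_div_of_nonneg_right _ (by positivity)
      linarith

lemma over_prob {n p : ℕ} (X : Matrix (Fin n) (Fin p) ℝ) (τ₀ : Finset (Fin p)) 
    (σ : ℝ) (hσ : 0 < σ) (u : Fin n → ℝ) (B : Finset (Fin p)) (κ : ℝ) :
    stdGaussian n {U | κ ≤ σ ^ 2 * (‖PW (Ws X u (τ₀ ∪ B)) (toE U)‖ ^ 2 -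
        ‖PW (Ws X u τ₀) (toE U)‖ ^ 2)} ≤
      ENNReal.ofReal (Real.sqrt 3 ^ B.card * Real.exp (-κ / (3 * σ ^ 2))) := by
  obtain ⟨k, hk, e, he, heW, hex⟩ := diffproj (Ws X u τ₀) (Ws X u (τ₀ ∪ B))
    (Ws_mono X u Finset.subset_union_left) B.card (Ws_finrank X u τ₀ B)
  refine (chernoff (fun U => (-0 * ‖toE U‖ ^ 2 + ∑ i, (1 / 3 : ℝ) * (inner ℝ (e i) (toE U)) ^ 2
      + inner ℝ (0 : Eu n) (toE U)) + (-κ / (3 * σ ^ 2))) (by fun_prop) _ ?_).trans ?_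
  · intro U hU
    have hU' : κ ≤ σ ^ 2 * (‖PW (Ws X u (τ₀ ∪ B)) (toE U)‖ ^ 2 -
        ‖PW (Ws X u τ₀) (toE U)‖ ^ 2) := hU
    rw [hex] at hU'
    rw [← Finset.mul_sum, inner_zero_left]
    have : (-0 * ‖toE U‖ ^ 2 + 1 / 3 * ∑ i, inner ℝ (e i) (toE U) ^ 2 + 0 +
      -κ / (3 * σ ^ 2)) = (σ ^ 2 * (∑ i, inner ℝ (e i) (toE U) ^ 2) - κ) / (3 * σ ^ 2) := by
      field_simp
      ring
    rw [this]
    apply div_nonneg <;> [linarith; positivity]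
  · have h1 : ∀ U : Fin n → ℝ, ENNReal.ofReal (Real.exp ((-0 * ‖toE U‖ ^ 2 +
        ∑ i, (1 / 3 : ℝ) * (inner ℝ (e i) (toE U)) ^ 2
        + inner ℝ (0 : Eu n) (toE U)) + (-κ / (3 * σ ^ 2)))) =
        ENNReal.ofReal (Real.exp (-0 * ‖toE U‖ ^ 2 +
        ∑ i, (1 / 3 : ℝ) * (inner ℝ (e i) (toE U)) ^ 2
        + inner ℝ (0 : Eu n) (toE U))) * ENNReal.ofReal (Real.exp (-κ / (3 * σ ^ 2))) := by
      intro U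
      rw [Real.exp_add _ (-κ / (3 * σ ^ 2)), ENNReal.ofReal_mul (Real.exp_pos _).le]
    rw [lintegral_congr h1, lintegral_mul_const _ (by fun_prop),
      master e he 0 (fun i => inner_zero_left _) 0
        (by norm_num) (fun _ => 1 / 3) (fun _ => by norm_num) (fun _ => by norm_num),
      ← ENNReal.ofReal_mul (by positivity)]
    apply ENNReal.ofReal_le_ofReal
    have h2 : (Real.sqrt (1 - 2 * (1 / 3 / (1 + 2 * 0))))⁻¹ = Real.sqrt 3 := by
      rw [← Real.sqrt_inv]; norm_num
    simp only [h2, Finset.prod_const, Finset.card_univ, Fintype.card_fin]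
    simp only [mul_zero, add_zero,
      Real.sqrt_one, inv_one, one_pow, one_mul, norm_zero]
    have h4 : Real.exp (0 ^ 2 / (2 * 1)) = 1 := by norm_num
    rw [h4, mul_one]
    apply mul_le_mul_of_nonneg_right _ (Real.exp_pos _).le
    exact pow_le_pow_right₀ (Real.one_le_sqrt.2 (by norm_num)) hk

lemma cap {n p : ℕ} (X : Matrix (Fin n) (Fin p) ℝ) (M : Eu n) (τ : Finset (Fin p)) :
    stdGaussian n {u | ‖M - PW (Ws X u τ) M‖ ^ 2 < 1 / 4 * ‖M - PW (Vs X τ) M‖ ^ 2} ≤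
      ENNReal.ofReal (3 * (Real.sqrt 3)⁻¹ ^ n * Real.sqrt 3 ^ τ.card) := by
  set V := Vs X τ with hV
  set r := M - PW V M with hr
  by_cases hr0 : r = 0
  · have : {u : Fin n → ℝ | ‖M - PW (Ws X u τ) M‖ ^ 2 < 1 / 4 * ‖r‖ ^ 2} = ∅ := by
      ext u
      simp only [hr0, norm_zero, Set.mem_ofPred_eq, Set.mem_empty_iff_false, iff_false, not_lt]
      norm_num
    rw [this, measure_empty]; exact zero_le
  have hrV : ∀ w ∈ V, inner ℝ r w = 0 := fun w hw =>
    Submodule.starProjection_inner_eq_zero (K := V) M _ hw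
  have hrn : 0 < ‖r‖ := norm_pos_iff.2 hr0
  obtain ⟨k, hk, e, he, heV, hex⟩ := PW_expand V τ.card (Vs_finrank X τ)
  let e' : Option (Fin k) → Eu n := fun o => o.elim (‖r‖⁻¹ • r) e
  have he' : Orthonormal ℝ e' := by
    rw [orthonormal_iff_ite] at he ⊢
    intro i j
    rcases i with _ | i <;> rcases j with _ | j
    · simp only [e', Option.elim, if_true]
      rw [real_inner_smul_left, real_inner_smul_right, real_inner_self_eq_norm_sq]
      field_simp
    · simp [e', real_inner_smul_left, hrV _ (heV j)]
    · simp [e', real_inner_smul_right, real_inner_comm r (e i), hrV _ (heV i)]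
    · simpa [e'] using he i j
  let a : Option (Fin k) → ℝ := fun o => o.elim (4 / 3) (fun _ => 1)
  refine (chernoff (fun U => (-1 * ‖toE U‖ ^ 2 + ∑ i, a i * (inner ℝ (e' i) (toE U)) ^ 2
      + inner ℝ (0 : Eu n) (toE U))) (by fun_prop) _ ?_).trans ?_
  · intro u hu
    have hu' : ‖M - PW (Ws X u τ) M‖ ^ 2 < 1 / 4 * ‖r‖ ^ 2 := hu
    obtain ⟨x, hx, z, hz, hxz⟩ := Submodule.mem_sup.1 (PW_mem (Ws X u τ) M)
    obtain ⟨c, hc⟩ := Submodule.mem_span_singleton.1 hz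
    set q := toE u - PW V (toE u) with hq
    have hqV : ∀ w ∈ V, inner ℝ q w = 0 := fun w hw =>
      Submodule.starProjection_inner_eq_zero (K := V) (toE u) _ hw
    set w := PW V M - x - c • PW V (toE u) with hw
    have hwV : w ∈ V := V.sub_mem (V.sub_mem (PW_mem _ _) hx) (V.smul_mem _ (PW_mem _ _))
    have hdec : M - PW (Ws X u τ) M = (r - c • q) + w := by
      rw [← hxz, ← hc, hr, hq, hw, smul_sub]; abel
    have h1 : ‖r - c • q‖ ^ 2 ≤ ‖M - PW (Ws X u τ) M‖ ^ 2 := by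
      rw [hdec, norm_add_sq_real, inner_sub_left, real_inner_smul_left, hrV w hwV, hqV w hwV]
      have := sq_nonneg ‖w‖
      linarith
    have h2 : ‖r - c • q‖ ^ 2 = ‖r‖ ^ 2 - 2 * c * inner ℝ r q + c ^ 2 * ‖q‖ ^ 2 := by
      rw [norm_sub_sq_real, real_inner_smul_right, norm_smul, mul_pow, Real.norm_eq_abs, sq_abs]
      ring
    have h3 : inner ℝ r q = inner ℝ r (toE u) := by
      rw [hq, inner_sub_right, hrV _ (PW_mem _ _), sub_zero]
    have h4 : ‖q‖ ^ 2 = ‖toE u‖ ^ 2 - ‖PW V (toE u)‖ ^ 2 := res_sq V (toE u)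
    have h5 : 3 / 4 * ‖r‖ ^ 2 * ‖q‖ ^ 2 ≤ (inner ℝ r (toE u)) ^ 2 := by
      rw [← h3]
      have h6 : ‖q‖ ^ 2 * ‖r - c • q‖ ^ 2 ≤ ‖q‖ ^ 2 * (1 / 4 * ‖r‖ ^ 2) :=
        mul_le_mul_of_nonneg_left (h1.trans hu'.le) (sq_nonneg _)
      rw [h2] at h6
      nlinarith [sq_nonneg (c * ‖q‖ ^ 2 - inner ℝ r q)]
    have h7 : (inner ℝ (‖r‖⁻¹ • r) (toE u)) ^ 2 = (inner ℝ r (toE u)) ^ 2 / ‖r‖ ^ 2 := by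
      rw [real_inner_smul_left]; field_simp
    have h8 : 3 / 4 * ‖q‖ ^ 2 ≤ (inner ℝ (‖r‖⁻¹ • r) (toE u)) ^ 2 := by
      rw [h7, le_div_iff₀ (by positivity)]; linarith
    rw [Fintype.sum_option, inner_zero_left]
    simp only [e', a, Option.elim, one_mul]
    rw [← hex (toE u)]
    linarith
  · rw [master e' he' 0 (fun i => inner_zero_left _) 1
        (by norm_num) a (fun i => by rcases i with _ | i <;> norm_num [a])
          (fun i => by rcases i with _ | i <;> norm_num [a])]
    apply ENNReal.ofReal_le_ofReal
    rw [Fintype.prod_option]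
    have h2 : (Real.sqrt (1 - 2 * (1 / (1 + 2 * 1))))⁻¹ = Real.sqrt 3 := by
      rw [← Real.sqrt_inv]; norm_num
    have h3 : (Real.sqrt (1 - 2 * (4 / 3 / (1 + 2 * 1))))⁻¹ = 3 := by
      rw [← Real.sqrt_inv, Real.sqrt_eq_iff_eq_sq] <;> norm_num
    have h5 : (1 + 2 * 1 : ℝ) = 3 := by norm_num
    simp only [a, Option.elim, h2, h3, Finset.prod_const, Finset.card_univ, Fintype.card_fin, norm_zero]
    have h4 : Real.exp (0 ^ 2 / (2 * (1 + 2 * 1))) = 1 := by norm_num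
    rw [h4, mul_one, h5]
    have h6 := pow_le_pow_right₀ (Real.one_le_sqrt.2 (by norm_num : (1:ℝ) ≤ 3)) hk
    have h7 : 0 ≤ (Real.sqrt 3)⁻¹ ^ n := by positivity
    have := mul_le_mul_of_nonneg_left h6 h7
    linarith


lemma sum_symmDiff {p : ℕ} (τ₀ : Finset (Fin p)) (y : ℝ) :
    ∑ τ : Finset (Fin p), y ^ ((τ \ τ₀).card + (τ₀ \ τ).card) = (1 + y) ^ p := by
  have h1 : ∀ τ : Finset (Fin p), (τ \ τ₀).card + (τ₀ \ τ).card = (symmDiff τ τ₀).card := by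
    intro τ
    rw [symmDiff_def, Finset.sup_eq_union, Finset.card_union_of_disjoint disjoint_sdiff_sdiff]
  have hinv : Function.Involutive (fun τ : Finset (Fin p) => symmDiff τ τ₀) :=
    fun τ => symmDiff_symmDiff_cancel_right τ₀ τ
  simp_rw [h1]
  have h2 := Equiv.sum_comp (hinv.toPerm) (fun τ : Finset (Fin p) => y ^ τ.card)
  have h3 : ∑ τ : Finset (Fin p), y ^ (symmDiff τ τ₀).card = ∑ τ : Finset (Fin p), y ^ τ.card := h2
  rw [h3]
  have h4 := Finset.prod_one_add (f := fun _ : Fin p => y) Finset.univ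
  simp only [Finset.prod_const, Finset.card_univ, Fintype.card_fin, Finset.powerset_univ] at h4
  rw [h4]

lemma under_num {p : ℕ} (τ₀ : Finset (Fin p)) (x : ℝ) (hx : 0 < x)
    (hT : 6 * ((p : ℝ) + 1) ^ 2 * x < 1) :
    ∑ τ ∈ Finset.univ.filter (fun τ : Finset (Fin p) => τ ≠ τ₀ ∧ τ.card ≤ τ₀.card),
      Real.sqrt 2 ^ (τ \ τ₀).card * x ^ (τ₀ \ τ).card ≤ 6 * ((p : ℝ) + 1) ^ 2 * x := by
  set T := 6 * ((p : ℝ) + 1) ^ 2 * x with hTd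
  set y : ℝ := 1 / ((p : ℝ) + 1) with hy
  have hp1 : (0 : ℝ) < (p : ℝ) + 1 := by positivity
  have hy0 : 0 < y := by positivity
  have hy1 : y ≤ 1 := by
    rw [hy, div_le_one hp1]; have : (0 : ℝ) ≤ p := by positivity
    linarith
  have hT0 : 0 < T := by positivity
  have hxT : x = T * y ^ 2 * (1 / 6) := by
    rw [hTd, hy]; field_simp
  have hpt : ∀ τ ∈ Finset.univ.filter (fun τ : Finset (Fin p) => τ ≠ τ₀ ∧ τ.card ≤ τ₀.card),
      Real.sqrt 2 ^ (τ \ τ₀).card * x ^ (τ₀ \ τ).card ≤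
        T / 3 * y ^ ((τ \ τ₀).card + (τ₀ \ τ).card) := by
    intro τ hτ
    obtain ⟨hne, hc⟩ := (Finset.mem_filter.1 hτ).2
    have hj : 1 ≤ (τ₀ \ τ).card := by
      rw [Nat.one_le_iff_ne_zero, Ne, Finset.card_eq_zero, Finset.sdiff_eq_empty_iff_subset]
      intro h
      exact hne (Finset.eq_of_subset_of_card_le h hc).symm
    have hmj : (τ \ τ₀).card ≤ (τ₀ \ τ).card := Finset.card_sdiff_le_card_sdiff_iff.2 hc
    set j := (τ₀ \ τ).card
    set m := (τ \ τ₀).card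
    have h2 : Real.sqrt 2 ^ m ≤ 2 ^ j := by
      calc Real.sqrt 2 ^ m ≤ Real.sqrt 2 ^ j :=
            pow_le_pow_right₀ (Real.one_le_sqrt.2 (by norm_num)) hmj
        _ ≤ 2 ^ j := by
            apply pow_le_pow_left₀ (by positivity)
            rw [Real.sqrt_le_left (by norm_num)]; norm_num
    calc Real.sqrt 2 ^ m * x ^ j ≤ 2 ^ j * x ^ j := mul_le_mul_of_nonneg_right h2 (by positivity)
      _ = T ^ j * (1 / 3) ^ j * (y ^ j * y ^ j) := by
          rw [hxT, ← mul_pow, ← mul_pow, ← mul_pow, ← mul_pow]; congr 1; ring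
      _ ≤ T * (1 / 3) * (y ^ m * y ^ j) := by
          have a1 : T ^ j ≤ T := pow_le_of_le_one hT0.le hT.le (by omega)
          have a2 : (1 / 3 : ℝ) ^ j ≤ 1 / 3 := pow_le_of_le_one (by norm_num) (by norm_num) (by omega)
          have a3 : y ^ j ≤ y ^ m := pow_le_pow_of_le_one hy0.le hy1 hmj
          gcongr
      _ = T / 3 * y ^ (m + j) := by rw [pow_add]; ring
  calc _ ≤ ∑ τ ∈ Finset.univ.filter (fun τ : Finset (Fin p) => τ ≠ τ₀ ∧ τ.card ≤ τ₀.card),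
        T / 3 * y ^ ((τ \ τ₀).card + (τ₀ \ τ).card) := Finset.sum_le_sum hpt
    _ ≤ ∑ τ : Finset (Fin p), T / 3 * y ^ ((τ \ τ₀).card + (τ₀ \ τ).card) :=
        Finset.sum_le_sum_of_subset_of_nonneg (Finset.filter_subset _ _)
          (fun _ _ _ => by positivity)
    _ = T / 3 * (1 + y) ^ p := by rw [← Finset.mul_sum, sum_symmDiff]
    _ ≤ T / 3 * 3 := by
        apply mul_le_mul_of_nonneg_left _ (by positivity)
        have h1 : 1 + y ≤ Real.exp y := by have := Real.add_one_le_exp y; linarith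
        calc (1 + y) ^ p ≤ (Real.exp y) ^ p := pow_le_pow_left₀ (by positivity) h1 _
          _ = Real.exp (p * y) := by rw [← Real.exp_nat_mul]
          _ ≤ Real.exp 1 := by
            apply Real.exp_le_exp.2
            rw [hy, mul_one_div, div_le_one hp1]; linarith
          _ ≤ 3 := by have := Real.exp_one_lt_d9; linarith
    _ = T := by ring

lemma over_num {p : ℕ} (hp : 2 ≤ p) (τ₀ : Finset (Fin p)) (hs : 1 ≤ τ₀.card) :
    ∑ B ∈ (τ₀ᶜ.powerset).erase ∅, (4 * Real.sqrt 3 / (p : ℝ) ^ 2) ^ B.card ≤ 3 := by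
  set y : ℝ := 4 * Real.sqrt 3 / (p : ℝ) ^ 2 with hy
  have hy0 : 0 ≤ y := by positivity
  have h3 : Real.sqrt 3 ≤ 1.7321 := by
    rw [Real.sqrt_le_left (by norm_num)]; norm_num
  have h4 := Finset.prod_one_add (f := fun _ : Fin p => y) τ₀ᶜ
  simp only [Finset.prod_const, Finset.card_compl, Fintype.card_fin] at h4
  have h5 := Finset.sum_erase_eq_sub (f := fun B : Finset (Fin p) => y ^ B.card)
    (Finset.empty_mem_powerset τ₀ᶜ)
  rw [h5, ← h4, Finset.card_empty, pow_zero]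
  have h6 : (1 + y) ^ (p - τ₀.card) ≤ (1 + y) ^ (p - 1) :=
    pow_le_pow_right₀ (by linarith) (by omega)
  suffices (1 + y) ^ (p - 1) ≤ 4 by linarith
  rcases Nat.lt_or_ge p 4 with hlt | hge
  · interval_cases p
    · norm_num at hy ⊢; rw [hy]; linarith
    · norm_num at hy ⊢
      have : y ≤ 0.77 := by rw [hy]; linarith
      nlinarith
  · have h1 : 1 + y ≤ Real.exp y := by have := Real.add_one_le_exp y; linarith
    have hp4 : (4 : ℝ) ≤ p := by exact_mod_cast hge
    calc (1 + y) ^ (p - 1) ≤ (Real.exp y) ^ (p - 1) := pow_le_pow_left₀ (by positivity) h1 _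
      _ = Real.exp (((p - 1 : ℕ) : ℝ) * y) := by rw [← Real.exp_nat_mul]
      _ ≤ Real.exp (2 * Real.log 2) := by
        apply Real.exp_le_exp.2
        rw [Nat.cast_sub (by omega), hy, mul_div_assoc', div_le_iff₀ (by positivity)]
        have := Real.log_two_gt_d9
        push_cast
        have h8 : ((p : ℝ) - 1) * (4 * Real.sqrt 3) ≤ ((p : ℝ) - 1) * (4 * 1.7321) := by
          apply mul_le_mul_of_nonneg_left _ (by linarith); linarith
        have h9 : 2 * 0.69 * (p : ℝ) ^ 2 ≤ 2 * Real.log 2 * (p : ℝ) ^ 2 := by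
          apply mul_le_mul_of_nonneg_right _ (by positivity); linarith
        nlinarith
      _ = 4 := by
        rw [mul_comm, Real.exp_mul, Real.exp_log (by norm_num)]; norm_num

lemma count_models {p : ℕ} (τ₀ : Finset (Fin p)) (hs : 1 ≤ τ₀.card) :
    (Finset.univ.filter (fun τ : Finset (Fin p) => τ ≠ τ₀ ∧ τ.card ≤ τ₀.card)).card ≤
      2 * p ^ τ₀.card := by
  have hp : 1 ≤ p := by
    have := Finset.card_le_univ τ₀
    rw [Fintype.card_fin] at this; omega
  have hsub : Finset.univ.filter (fun τ : Finset (Fin p) => τ ≠ τ₀ ∧ τ.card ≤ τ₀.card) ⊆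
      {∅} ∪ Finset.univ.image (fun f : Fin τ₀.card → Fin p => Finset.univ.image f) := by
    intro τ hτ
    obtain ⟨hne, hc⟩ := (Finset.mem_filter.1 hτ).2
    rw [Finset.mem_union]
    rcases τ.eq_empty_or_nonempty with h | h
    · left; simp [h]
    · right
      rw [Finset.mem_image]
      have hn : Nonempty {x // x ∈ τ} := h.to_subtype
      obtain ⟨g⟩ := Function.Embedding.nonempty_of_card_le (α := {x // x ∈ τ}) (β := Fin τ₀.card)
        (by simpa using hc)
      have hsurj := Function.invFun_surjective g.injective
      let f : Fin τ₀.card → {x // x ∈ τ} := Function.invFun g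
      refine ⟨fun i => (f i).1, Finset.mem_univ _, ?_⟩
      ext x
      simp only [Finset.mem_image, Finset.mem_univ, true_and]
      constructor
      · rintro ⟨i, rfl⟩; exact (f i).2
      · intro hx
        obtain ⟨i, hi⟩ := hsurj ⟨x, hx⟩
        exact ⟨i, congrArg Subtype.val hi⟩
  have h1 := (Finset.card_le_card hsub).trans (Finset.card_union_le _ _)
  have h2 : (Finset.univ.image (fun f : Fin τ₀.card → Fin p => Finset.univ.image f)).card
      ≤ p ^ τ₀.card := by
    refine Finset.card_image_le.trans ?_
    simp
  have h3 : 1 ≤ p ^ τ₀.card := Nat.one_le_pow _ _ hp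
  rw [Finset.card_singleton] at h1
  omega

lemma cap_num (n p s : ℕ) (hp : 1 ≤ p) (hs : 1 ≤ s) (hsp : s ≤ p)
    (h : (s : ℝ) * Real.log p + 2 < 0.23 * n) :
    2 * (p : ℝ) ^ s * (3 * (Real.sqrt 3)⁻¹ ^ n * Real.sqrt 3 ^ s) ≤
      Real.exp (s * Real.log p + 2 - 0.23 * n) := by
  have hpp : (0 : ℝ) < p := by exact_mod_cast hp
  have hl2 := Real.log_two_gt_d9
  have hl2' := Real.log_two_lt_d9
  have hl3 : 3 * Real.log 2 ≤ 2 * Real.log 3 := by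
    have := Real.log_le_log (by norm_num) (by norm_num : (2 : ℝ) ^ 3 ≤ 3 ^ 2)
    rwa [Real.log_pow, Real.log_pow] at this
  have hl3' : 5 * Real.log 3 ≤ 8 * Real.log 2 := by
    have := Real.log_le_log (by norm_num) (by norm_num : (3 : ℝ) ^ 5 ≤ 2 ^ 8)
    rwa [Real.log_pow, Real.log_pow] at this
  have hs3 : Real.sqrt 3 = Real.exp (Real.log 3 / 2) := by
    rw [← Real.log_sqrt (by norm_num), Real.exp_log (by positivity)]
  have e1 : (p : ℝ) ^ s = Real.exp (s * Real.log p) := by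
    rw [Real.exp_nat_mul, Real.exp_log hpp]
  have e2 : (6 : ℝ) = Real.exp (Real.log 2 + Real.log 3) := by
    rw [Real.exp_add, Real.exp_log, Real.exp_log] <;> norm_num
  have : 2 * (p : ℝ) ^ s * (3 * (Real.sqrt 3)⁻¹ ^ n * Real.sqrt 3 ^ s) =
      6 * (p : ℝ) ^ s * (Real.sqrt 3)⁻¹ ^ n * Real.sqrt 3 ^ s := by ring
  rw [this, e1, e2, hs3, ← Real.exp_neg, ← Real.exp_nat_mul, ← Real.exp_nat_mul, ← Real.exp_add,
    ← Real.exp_add, ← Real.exp_add]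
  apply Real.exp_le_exp.2
  have hsn : (s : ℝ) ≤ 0.5 * n := by
    rcases Nat.lt_or_ge p 2 with hlt | hge
    · have hp1 : p = 1 := by omega
      subst hp1
      have hs1 : s = 1 := by omega
      subst hs1
      norm_num at h ⊢
      linarith
    · have : Real.log 2 ≤ Real.log p :=
        Real.log_le_log (by norm_num) (by exact_mod_cast hge)
      have hs0 : (0 : ℝ) ≤ s := by positivity
      have h2 : (s : ℝ) * 0.69 ≤ s * Real.log p := mul_le_mul_of_nonneg_left (by linarith) hs0
      have hn0 : (0 : ℝ) ≤ n := by positivity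
      linarith
  have hm : ((n : ℝ) - s) * 0.51 ≤ ((n : ℝ) - s) * (Real.log 3 / 2) :=
    mul_le_mul_of_nonneg_left (by linarith) (by
      have hn0 : (0 : ℝ) ≤ n := by positivity
      linarith)
  have hn0 : (0 : ℝ) ≤ n := by positivity
  linarith



lemma meas_obj {n p : ℕ} (X : Matrix (Fin n) (Fin p) ℝ) (lam : ℝ) (μ : Fin n → ℝ) (σ : ℝ)
    (τ : Finset (Fin p)) :
    Measurable (fun q : (Fin n → ℝ) × (Fin n → ℝ) => objPen X lam (μ + σ • q.1) q.2 τ) := by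
  unfold objPen
  refine Measurable.add_const ?_ _
  apply UpperSemicontinuous.measurable
  apply upperSemicontinuous_ciInf
  · intro q
    refine ⟨0, ?_⟩
    rintro _ ⟨bs, rfl⟩
    exact Finset.sum_nonneg fun i _ => sq_nonneg _
  · intro bs
    apply Continuous.upperSemicontinuous
    unfold sqnorm
    simp only [Pi.sub_apply, Pi.add_apply, Pi.smul_apply]
    fun_prop

lemma over_pt (n p s m K : ℕ) (hp : 2 ≤ p) (σ t lam : ℝ) (hσ : 0 < σ) (ht : 0 < t)
    (hK : 1 ≤ K) (hm : m ≤ (s + 1) * K)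
    (hl : 6 * σ ^ 2 * ((s : ℝ) + 1) * Real.log ((p : ℝ) / 2) + n * t ≤ lam) :
    Real.sqrt 3 ^ m * Real.exp (-(lam * K) / (3 * σ ^ 2)) ≤
      Real.exp (-((n : ℝ) * t) / (3 * σ ^ 2)) * (4 * Real.sqrt 3 / (p : ℝ) ^ 2) ^ m := by
  have hp' : (2 : ℝ) ≤ p := by exact_mod_cast hp
  have hlog : 0 ≤ Real.log ((p : ℝ) / 2) := Real.log_nonneg (by linarith)
  have hK' : (1 : ℝ) ≤ K := by exact_mod_cast hK
  have hm' : (m : ℝ) ≤ ((s : ℝ) + 1) * K := by exact_mod_cast hm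
  have h4 : (4 / (p : ℝ) ^ 2) ^ m = Real.exp (-(2 * m * Real.log ((p : ℝ) / 2))) := by
    have : 4 / (p : ℝ) ^ 2 = Real.exp (-(2 * Real.log ((p : ℝ) / 2))) := by
      rw [Real.exp_neg, mul_comm, Real.exp_mul, Real.exp_log (by linarith)]
      norm_num
      field_simp
      norm_num
    rw [this, ← Real.exp_nat_mul]; congr 1; ring
  have h5 : (4 * Real.sqrt 3 / (p : ℝ) ^ 2) ^ m = Real.sqrt 3 ^ m * (4 / (p : ℝ) ^ 2) ^ m := by
    rw [← mul_pow]; congr 1; ring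
  rw [h5, mul_left_comm, h4, ← Real.exp_add]
  refine mul_le_mul_of_nonneg_left (Real.exp_le_exp.2 ?_) (by positivity)
  have hs2 : 0 < 3 * σ ^ 2 := by positivity
  rw [div_add' _ _ _ hs2.ne']
  refine div_le_div_of_nonneg_right ?_ hs2.le
  have h6 : (6 * σ ^ 2 * ((s : ℝ) + 1) * Real.log ((p : ℝ) / 2) + n * t) * K ≤ lam * K :=
    mul_le_mul_of_nonneg_right hl (by linarith)
  have h7 : 0 ≤ (n : ℝ) * t := by positivity
  have h8 : (n : ℝ) * t * 1 ≤ n * t * K := mul_le_mul_of_nonneg_left hK' h7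
  have h9 : (6 * σ ^ 2 * Real.log ((p : ℝ) / 2)) * m ≤
    (6 * σ ^ 2 * Real.log ((p : ℝ) / 2)) * (((s : ℝ) + 1) * K) :=
    mul_le_mul_of_nonneg_left hm' (by positivity)
  nlinarith

lemma card_facts {p : ℕ} (τ₀ τ : Finset (Fin p)) :
    τ.card + (τ₀ \ τ).card = τ₀.card + (τ \ τ₀).card := by
  have h1 := Finset.card_sdiff_add_card_inter τ τ₀
  have h2 := Finset.card_sdiff_add_card_inter τ₀ τ
  rw [Finset.inter_comm] at h2
  omega

/-- good direction bound -/
lemma good_bound {n p : ℕ} (X : Matrix (Fin n) (Fin p) ℝ) (τ₀ : Finset (Fin p)) (β₀ : Fin p → ℝ)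
    (hn : 0 < n) (hs : 1 ≤ τ₀.card)
    (hμ : toE (X.mulVec β₀) ∈ Vs X τ₀) (σ : ℝ) (hσ : 0 < σ)
    (hGram : ∀ τ : Finset (Fin p), τ.card ≤ τ₀.card →
      IsUnit ((subcols X τ)ᵀ * subcols X τ).det)
    (t lam C : ℝ) (ht : 0 < t) (hC : C = Cmin X τ₀ β₀) (hC0 : 0 < C)
    (hl1 : 6 * σ ^ 2 * ((τ₀.card : ℝ) + 1) * Real.log ((p : ℝ) / 2) + n * t ≤ lam)
    (hl2 : lam ≤ 0.05 * C * n)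
    (hT : 6 * ((p : ℝ) + 1) ^ 2 * Real.exp (-(n * C / (60 * σ ^ 2))) < 1)
    (u : Fin n → ℝ)
    (hu : ∀ τ : Finset (Fin p), τ ≠ τ₀ → τ.card ≤ τ₀.card →
      1 / 4 * ‖toE (X.mulVec β₀) - PW (Vs X τ) (toE (X.mulVec β₀))‖ ^ 2 ≤
        ‖toE (X.mulVec β₀) - PW (Ws X u τ) (toE (X.mulVec β₀))‖ ^ 2) :
    stdGaussian n {U | ∃ τ, τ ≠ τ₀ ∧ objPen X lam (X.mulVec β₀ + σ • U) u τ ≤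
        objPen X lam (X.mulVec β₀ + σ • U) u τ₀} ≤
      ENNReal.ofReal (6 * ((p : ℝ) + 1) ^ 2 * Real.exp (-(n * C / (60 * σ ^ 2)))) +
        ENNReal.ofReal (3 * Real.exp (-((n : ℝ) * t) / (3 * σ ^ 2))) := by
  set μ := X.mulVec β₀ with hμd
  set x := Real.exp (-(n * C / (60 * σ ^ 2))) with hx
  set z := Real.exp (-((n : ℝ) * t) / (3 * σ ^ 2)) with hz
  set F := Finset.univ.filter (fun τ : Finset (Fin p) => τ ≠ τ₀ ∧ τ.card ≤ τ₀.card) with hF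
  let EU : Finset (Fin p) → Set (Fin n → ℝ) := fun τ =>
    {U | objPen X lam (μ + σ • U) u τ ≤ objPen X lam (μ + σ • U) u τ₀}
  let K : Finset (Fin p) → ℕ := fun B => max 1 (B.card - τ₀.card)
  let EO : Finset (Fin p) → Set (Fin n → ℝ) := fun B =>
    {U | lam * (K B : ℝ) ≤ σ ^ 2 * (‖PW (Ws X u (τ₀ ∪ B)) (toE U)‖ ^ 2 -
        ‖PW (Ws X u τ₀) (toE U)‖ ^ 2)}
  set BB : Finset (Finset (Fin p)) := (τ₀ᶜ.powerset).erase ∅ with hBB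
  have hnR : (0 : ℝ) < n := by exact_mod_cast hn
  have hp1 : 1 ≤ p := by
    have := Finset.card_le_univ τ₀
    rw [Fintype.card_fin] at this; omega
  -- under part
  have hU : stdGaussian n (⋃ τ ∈ F, EU τ) ≤ ENNReal.ofReal (6 * ((p : ℝ) + 1) ^ 2 * x) := by
    refine (measure_biUnion_finset_le _ _).trans ?_
    refine le_trans ?_ (ENNReal.ofReal_le_ofReal (under_num τ₀ x (Real.exp_pos _) hT))
    rw [ENNReal.ofReal_sum_of_nonneg (fun τ _ => by positivity)]
    refine Finset.sum_le_sum fun τ hτ => ?_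
    obtain ⟨hne, hc⟩ := (Finset.mem_filter.1 hτ).2
    have hcm := Cmin_le X τ₀ β₀ hn τ hne hc (hGram τ hc)
    rw [← hC, ← hμd] at hcm
    have hcf := card_facts τ₀ τ
    have hcfR : (τ.card : ℝ) + ((τ₀ \ τ).card : ℝ) = τ₀.card + ((τ \ τ₀).card : ℝ) := by
      exact_mod_cast hcf
    have hcR : (τ.card : ℝ) ≤ τ₀.card := by exact_mod_cast hc
    have hm0 : (0 : ℝ) ≤ ((τ \ τ₀).card : ℝ) := by positivity
    have hnC : 0 < 0.05 * C * n := by positivity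
    refine (under_prob X τ₀ μ hμ σ hσ lam u τ (n * (τ₀ \ τ).card * C / 4)
      (0.05 * C * n * (τ₀ \ τ).card) ?_ ?_).trans ?_
    · have := hu τ hne hc
      linarith
    · refine (mul_le_mul_of_nonneg_right hl2 (by linarith)).trans ?_
      exact mul_le_mul_of_nonneg_left (by linarith) hnC.le
    · refine ENNReal.ofReal_le_ofReal (mul_le_mul_of_nonneg_left ?_ (by positivity))
      rw [hx, ← Real.exp_nat_mul]
      refine Real.exp_le_exp.2 ?_
      have e1 : ((τ₀ \ τ).card : ℝ) * -(n * C / (60 * σ ^ 2)) =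
        -(n * (τ₀ \ τ).card * C / 60) / σ ^ 2 := by field_simp
      rw [e1]
      refine div_le_div_of_nonneg_right ?_ (by positivity)
      have : 0 ≤ n * ((τ₀ \ τ).card : ℝ) * C := by positivity
      linarith
  -- over part
  by_cases hp2 : 2 ≤ p
  · have hp' : (2 : ℝ) ≤ p := by exact_mod_cast hp2
    have hlog : 0 ≤ Real.log ((p : ℝ) / 2) := Real.log_nonneg (by linarith)
    have hlam0 : 0 ≤ lam := le_trans (by positivity) hl1
    have hO : stdGaussian n (⋃ B ∈ BB, EO B) ≤ ENNReal.ofReal (3 * z) := by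
      refine (measure_biUnion_finset_le _ _).trans ?_
      have hon := over_num hp2 τ₀ hs
      have h1 : ∑ B ∈ BB, z * (4 * Real.sqrt 3 / (p : ℝ) ^ 2) ^ B.card ≤ 3 * z := by
        rw [← Finset.mul_sum, mul_comm]
        exact mul_le_mul_of_nonneg_right hon (Real.exp_pos _).le
      refine le_trans ?_ (ENNReal.ofReal_le_ofReal h1)
      rw [ENNReal.ofReal_sum_of_nonneg (fun τ _ => by positivity)]
      refine Finset.sum_le_sum fun B hB => ?_
      refine (over_prob X τ₀ σ hσ u B (lam * (K B : ℝ))).trans (ENNReal.ofReal_le_ofReal ?_)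
      refine over_pt n p τ₀.card B.card (K B) hp2 σ t lam hσ ht (le_max_left _ _) ?_ hl1
      have h1 : 1 ≤ K B := le_max_left _ _
      have h2 : B.card - τ₀.card ≤ K B := le_max_right _ _
      have h3 : τ₀.card * 1 ≤ τ₀.card * K B := Nat.mul_le_mul_left _ h1
      rw [add_mul]; omega
    refine le_trans (measure_mono ?_) ((measure_union_le _ _).trans (add_le_add hU hO))
    rintro U ⟨τ, hne, hle⟩
    by_cases hc : τ.card ≤ τ₀.card
    · left
      exact Set.mem_biUnion (Finset.mem_filter.2 ⟨Finset.mem_univ _, hne, hc⟩) hle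
    · right
      have hcf := card_facts τ₀ τ
      have hB : τ \ τ₀ ∈ BB := by
        rw [hBB, Finset.mem_erase, Finset.mem_powerset]
        refine ⟨?_, ?_⟩
        · rw [← Finset.nonempty_iff_ne_empty, ← Finset.card_pos]; omega
        · intro j hj
          rw [Finset.mem_compl]; exact (Finset.mem_sdiff.1 hj).2
      refine Set.mem_biUnion hB ?_
      show lam * (K (τ \ τ₀) : ℝ) ≤ _
      have hKle : K (τ \ τ₀) + τ₀.card ≤ τ.card := by
        have : K (τ \ τ₀) = max 1 ((τ \ τ₀).card - τ₀.card) := rfl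
        have h2 : (τ₀ \ τ).card ≤ τ₀.card := Finset.card_le_card Finset.sdiff_subset
        rw [this]; omega
      have hKR : (K (τ \ τ₀) : ℝ) + τ₀.card ≤ τ.card := by exact_mod_cast hKle
      rw [objPen_eq, objPen_eq] at hle
      have hy : toE (μ + σ • U) = toE μ + σ • toE U := rfl
      have hsub : τ ⊆ τ₀ ∪ (τ \ τ₀) := by
        rw [Finset.union_sdiff_self_eq_union]; exact Finset.subset_union_right
      have hmono := PW_mono _ _ (Ws_mono X u hsub) (toE (μ + σ • U))
      have e1 := res_sq (Ws X u τ) (toE (μ + σ • U))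
      have e2 := res_sq (Ws X u (τ₀ ∪ (τ \ τ₀))) (toE (μ + σ • U))
      have m0 : toE μ ∈ Ws X u τ₀ := (le_sup_left : Vs X τ₀ ≤ Ws X u τ₀) hμ
      have m1 : toE μ ∈ Ws X u (τ₀ ∪ (τ \ τ₀)) := Ws_mono X u Finset.subset_union_left m0
      have r0 := res_expand (Ws X u τ₀) (toE μ) (toE U) σ
      have r1 := res_expand (Ws X u (τ₀ ∪ (τ \ τ₀))) (toE μ) (toE U) σ
      rw [res_zero _ _ m0, ← hy] at r0
      rw [res_zero _ _ m1, ← hy] at r1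
      simp only [norm_zero, inner_zero_left] at r0 r1
      have := mul_le_mul_of_nonneg_left hKR hlam0
      nlinarith
  · refine le_trans (measure_mono ?_) (hU.trans le_self_add)
    rintro U ⟨τ, hne, hle⟩
    have h1 := Finset.card_le_univ τ
    rw [Fintype.card_fin] at h1
    exact Set.mem_biUnion (Finset.mem_filter.2 ⟨Finset.mem_univ _, hne, by omega⟩) hle

lemma bad_dir {n p : ℕ} (X : Matrix (Fin n) (Fin p) ℝ) (τ₀ : Finset (Fin p)) (M : Eu n)
    (hs : 1 ≤ τ₀.card) (hw : (τ₀.card : ℝ) * Real.log p + 2 < 0.23 * n) :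
    stdGaussian n {u | ∃ τ : Finset (Fin p), (τ ≠ τ₀ ∧ τ.card ≤ τ₀.card) ∧
      ‖M - PW (Ws X u τ) M‖ ^ 2 < 1 / 4 * ‖M - PW (Vs X τ) M‖ ^ 2} ≤
      ENNReal.ofReal (Real.exp ((τ₀.card : ℝ) * Real.log p + 2 - 0.23 * n)) := by
  have hsp := Finset.card_le_univ τ₀
  rw [Fintype.card_fin] at hsp
  set F := Finset.univ.filter (fun τ : Finset (Fin p) => τ ≠ τ₀ ∧ τ.card ≤ τ₀.card) with hF
  refine le_trans ?_ (ENNReal.ofReal_le_ofReal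
    (cap_num n p τ₀.card (hs.trans hsp) hs hsp hw))
  have hsub : {u : Fin n → ℝ | ∃ τ : Finset (Fin p), (τ ≠ τ₀ ∧ τ.card ≤ τ₀.card) ∧
      ‖M - PW (Ws X u τ) M‖ ^ 2 < 1 / 4 * ‖M - PW (Vs X τ) M‖ ^ 2} ⊆
      ⋃ τ ∈ F, {u | ‖M - PW (Ws X u τ) M‖ ^ 2 < 1 / 4 * ‖M - PW (Vs X τ) M‖ ^ 2} := by
    rintro u ⟨τ, h1, h2⟩
    exact Set.mem_biUnion (Finset.mem_filter.2 ⟨Finset.mem_univ _, h1⟩) h2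
  refine (measure_mono hsub).trans ((measure_biUnion_finset_le _ _).trans ?_)
  have h3 : ∀ τ ∈ F, stdGaussian n
      {u | ‖M - PW (Ws X u τ) M‖ ^ 2 < 1 / 4 * ‖M - PW (Vs X τ) M‖ ^ 2} ≤
      ENNReal.ofReal (3 * (Real.sqrt 3)⁻¹ ^ n * Real.sqrt 3 ^ τ₀.card) := by
    intro τ hτ
    refine (cap X M τ).trans (ENNReal.ofReal_le_ofReal ?_)
    refine mul_le_mul_of_nonneg_left ?_ (by positivity)
    exact pow_le_pow_right₀ (Real.one_le_sqrt.2 (by norm_num)) (Finset.mem_filter.1 hτ).2.2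
  refine (Finset.sum_le_sum h3).trans ?_
  rw [Finset.sum_const, nsmul_eq_mul, ENNReal.ofReal_mul (p := 2 * (p : ℝ) ^ τ₀.card) (by positivity)]
  refine mul_le_mul_left ?_ _
  have := count_models τ₀ hs
  calc ((F.card : ℕ) : ℝ≥0∞) ≤ ((2 * p ^ τ₀.card : ℕ) : ℝ≥0∞) := by exact_mod_cast this
    _ = ENNReal.ofReal ((2 * p ^ τ₀.card : ℕ) : ℝ) := (ENNReal.ofReal_natCast _).symm
    _ ≤ _ := by push_cast; exact le_rfl


/-- **Theorem 2.2.** Large-sample (finite-`d`) bound for the penalized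
repro-samples candidate set. -/
theorem model_candidate_set_large_sample {n p : ℕ}
    (X : Matrix (Fin n) (Fin p) ℝ) (τ₀ : Finset (Fin p)) (β₀ : Fin p → ℝ)
    (hβsupp : ∀ j ∉ τ₀, β₀ j = 0) (hβne : ∀ j ∈ τ₀, β₀ j ≠ 0)
    (σ₀ : ℝ) (hσ₀ : 0 < σ₀)
    (hGram : ∀ τ : Finset (Fin p), τ.card ≤ τ₀.card →
      IsUnit ((subcols X τ)ᵀ * subcols X τ).det)
    (hid : Identifiable X τ₀ β₀)
    (t : ℝ) (ht : 0 < t) (lam : ℝ)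
    (hlam : lam / (n : ℝ) ∈ Set.Icc
      (6 * σ₀ ^ 2 * ((τ₀.card : ℝ) + 1) * Real.log ((p : ℝ)/2) / (n : ℝ) + t)
      (0.05 * Cmin X τ₀ β₀))
    (tauHat : (Fin n → ℝ) → (Fin n → ℝ) → Finset (Fin p))
    (hmin : ∀ (y ustar : Fin n → ℝ) (τ : Finset (Fin p)),
      objPen X lam y ustar (tauHat y ustar) ≤ objPen X lam y ustar τ)
    (d : ℕ) :
    jointMeasure n d
        {ω | ∀ b : Fin d, tauHat (X.mulVec β₀ + σ₀ • ω.1) (ω.2 b) ≠ τ₀} ≤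
      ENNReal.ofReal
        (6 * Real.exp (-((n : ℝ) / (18 * σ₀ ^ 2)) *
            (0.3 * Cmin X τ₀ β₀ - 36 * (Real.log ((p : ℝ) + 1) / (n : ℝ)) * σ₀ ^ 2)) +
          3 * Real.exp (-((n : ℝ) * t) / (3 * σ₀ ^ 2)) +
          Real.exp (-((n : ℝ) * (d : ℝ)) *
            (0.23 - ((τ₀.card : ℝ) * Real.log (p : ℝ) + 2) / (n : ℝ)))) := by
  have hprob : IsProbabilityMeasure (jointMeasure n d) := by
    unfold jointMeasure; infer_instance
  set C := Cmin X τ₀ β₀ with hC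
  set T1 := 6 * Real.exp (-((n : ℝ) / (18 * σ₀ ^ 2)) *
            (0.3 * C - 36 * (Real.log ((p : ℝ) + 1) / (n : ℝ)) * σ₀ ^ 2)) with hT1
  set T2 := 3 * Real.exp (-((n : ℝ) * t) / (3 * σ₀ ^ 2)) with hT2
  set T3 := Real.exp (-((n : ℝ) * (d : ℝ)) *
            (0.23 - ((τ₀.card : ℝ) * Real.log (p : ℝ) + 2) / (n : ℝ))) with hT3
  have hT1p : 0 < T1 := by positivity
  have hT2p : 0 < T2 := by positivity
  have hT3p : 0 < T3 := Real.exp_pos _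
  have triv : 1 ≤ T1 + T2 + T3 → jointMeasure n d
        {ω | ∀ b : Fin d, tauHat (X.mulVec β₀ + σ₀ • ω.1) (ω.2 b) ≠ τ₀} ≤
      ENNReal.ofReal (T1 + T2 + T3) := fun h =>
    prob_le_one.trans (by rw [← ENNReal.ofReal_one]; exact ENNReal.ofReal_le_ofReal h)
  obtain ⟨hlo, hhi⟩ := hlam
  have hCpos : 0 < C ∨ n = 0 ∨ C ≤ 0 := by
    rcases lt_or_ge 0 C with h | h
    · exact Or.inl h
    · exact Or.inr (Or.inr h)
  rcases Nat.eq_zero_or_pos n with hn0 | hn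
  · apply triv
    have : T3 = 1 := by rw [hT3, hn0]; simp
    linarith
  have hnR : (0 : ℝ) < n := by exact_mod_cast hn
  have hpp : (0 : ℝ) < (p : ℝ) + 1 := by positivity
  have hT1e : T1 = 6 * ((p : ℝ) + 1) ^ 2 * Real.exp (-(n * C / (60 * σ₀ ^ 2))) := by
    have : -((n : ℝ) / (18 * σ₀ ^ 2)) *
            (0.3 * C - 36 * (Real.log ((p : ℝ) + 1) / (n : ℝ)) * σ₀ ^ 2) =
        Real.log ((p : ℝ) + 1) * (2 : ℕ) + -(n * C / (60 * σ₀ ^ 2)) := by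
      push_cast
      field_simp
      ring
    rw [hT1, this, Real.exp_add, Real.exp_mul, Real.exp_log hpp, Real.rpow_natCast, mul_assoc]
  rcases le_or_gt 1 T1 with h1 | h1
  · exact triv (by linarith)
  rcases le_or_gt 1 T3 with h3 | h3
  · exact triv (by linarith)
  have hC0 : 0 < C := by
    by_contra hcon
    push Not at hcon
    have e1 : 1 ≤ Real.exp (-(n * C / (60 * σ₀ ^ 2))) := by
      apply Real.one_le_exp
      have : n * C / (60 * σ₀ ^ 2) ≤ 0 :=
        div_nonpos_of_nonpos_of_nonneg (mul_nonpos_of_nonneg_of_nonpos hnR.le hcon) (by positivity)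
      linarith
    have e2 : (1 : ℝ) ≤ ((p : ℝ) + 1) ^ 2 := one_le_pow₀ (by linarith [(Nat.cast_nonneg p : (0 : ℝ) ≤ p)])
    have e3 : 1 * 1 ≤ ((p : ℝ) + 1) ^ 2 * Real.exp (-(n * C / (60 * σ₀ ^ 2))) :=
      mul_le_mul e2 e1 (by norm_num) (by positivity)
    rw [hT1e, mul_assoc] at h1
    linarith
  have hs : 1 ≤ τ₀.card := by
    by_contra hcon
    have h0 : τ₀ = ∅ := by rw [← Finset.card_eq_zero]; omega
    have : C = 0 := by
      rw [hC, Cmin]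
      have : {τ : Finset (Fin p) | τ ≠ τ₀ ∧ τ.card ≤ τ₀.card} = ∅ := by
        ext τ
        simp [h0]
      rw [this, Set.image_empty, Real.sInf_empty]
    linarith
  set w : ℝ := (τ₀.card : ℝ) * Real.log p + 2 - 0.23 * n with hw
  have hT3e : T3 = Real.exp w ^ d := by
    rw [hT3, ← Real.exp_nat_mul]
    congr 1
    rw [hw]
    field_simp
    ring
  have hwneg : w < 0 := by
    by_contra hcon
    push Not at hcon
    have := one_le_pow₀ (n := d) (Real.one_le_exp hcon)
    linarith
  have hl1 : 6 * σ₀ ^ 2 * ((τ₀.card : ℝ) + 1) * Real.log ((p : ℝ) / 2) + n * t ≤ lam := by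
    have h := mul_le_mul_of_nonneg_right hlo hnR.le
    rw [div_mul_cancel₀ _ hnR.ne', add_mul, div_mul_cancel₀ _ hnR.ne'] at h
    linarith
  have hl2 : lam ≤ 0.05 * C * n := by
    rwa [div_le_iff₀ hnR] at hhi
  have hmask : maskOn τ₀ β₀ = β₀ := by
    funext j
    unfold maskOn
    split_ifs with h
    · rfl
    · exact (hβsupp j h).symm
  have hμ : toE (X.mulVec β₀) ∈ Vs X τ₀ := by
    have := mask_mem X τ₀ β₀
    rwa [hmask] at this
  set M := toE (X.mulVec β₀) with hM
  let A : Set (Fin n → ℝ) := {u | ∃ τ : Finset (Fin p), (τ ≠ τ₀ ∧ τ.card ≤ τ₀.card) ∧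
      ‖M - PW (Ws X u τ) M‖ ^ 2 < 1 / 4 * ‖M - PW (Vs X τ) M‖ ^ 2}
  have hA : stdGaussian n A ≤ ENNReal.ofReal (Real.exp w) :=
    bad_dir X τ₀ M hs (by rw [hw] at hwneg; linarith)
  let G : Set ((Fin n → ℝ) × (Fin n → ℝ)) := {q | ∃ τ, τ ≠ τ₀ ∧
    objPen X lam (X.mulVec β₀ + σ₀ • q.1) q.2 τ ≤ objPen X lam (X.mulVec β₀ + σ₀ • q.1) q.2 τ₀}
  have hGm : MeasurableSet G := by
    have : G = ⋃ τ : Finset (Fin p), ⋃ _ : τ ≠ τ₀,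
      {q | objPen X lam (X.mulVec β₀ + σ₀ • q.1) q.2 τ ≤
        objPen X lam (X.mulVec β₀ + σ₀ • q.1) q.2 τ₀} := by
      ext q
      simp only [G, Set.mem_ofPred_eq, Set.mem_iUnion, exists_prop]
    rw [this]
    exact MeasurableSet.iUnion fun τ => MeasurableSet.iUnion fun _ =>
      measurableSet_le (meas_obj X lam _ σ₀ τ) (meas_obj X lam _ σ₀ τ₀)
  let S : Set ((Fin n → ℝ) × (Fin d → Fin n → ℝ)) := {ω | ∀ b : Fin d, (ω.1, ω.2 b) ∈ G}
  have hSm : MeasurableSet S := by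
    have : S = ⋂ b : Fin d, (fun ω : (Fin n → ℝ) × (Fin d → Fin n → ℝ) => (ω.1, ω.2 b)) ⁻¹' G := by
      ext ω
      simp [S]
    rw [this]
    refine MeasurableSet.iInter fun b => ?_
    refine (measurable_fst.prodMk ((measurable_pi_apply b).comp measurable_snd)) hGm
  have hsub : {ω : (Fin n → ℝ) × (Fin d → Fin n → ℝ) |
      ∀ b : Fin d, tauHat (X.mulVec β₀ + σ₀ • ω.1) (ω.2 b) ≠ τ₀} ⊆ S := by
    intro ω hω b
    exact ⟨_, hω b, hmin _ _ _⟩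
  set q : ℝ≥0∞ := ENNReal.ofReal T1 + ENNReal.ofReal T2 with hq
  have hgood : ∀ u : Fin n → ℝ, u ∉ A → stdGaussian n {U | (U, u) ∈ G} ≤ q := by
    intro u hu
    rw [hq, hT1e]
    refine good_bound X τ₀ β₀ hn hs hμ σ₀ hσ₀ hGram t lam C ht hC hC0 hl1 hl2
      (by rw [← hT1e]; exact h1) u ?_
    intro τ hne hc
    by_contra hcon
    push Not at hcon
    exact hu ⟨τ, ⟨hne, hc⟩, hcon⟩
  let AA : Set (Fin d → Fin n → ℝ) := Set.pi Set.univ (fun _ => A)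
  calc jointMeasure n d _ ≤ jointMeasure n d S := measure_mono hsub
    _ = ∫⁻ v, stdGaussian n ((fun U => (U, v)) ⁻¹' S) ∂(Measure.pi fun _ : Fin d => stdGaussian n) := by
        unfold jointMeasure
        rw [Measure.prod_apply_symm hSm]
    _ ≤ ∫⁻ v, (AA.indicator 1 v + q) ∂(Measure.pi fun _ : Fin d => stdGaussian n) := by
        refine lintegral_mono fun v => ?_
        by_cases hv : v ∈ AA
        · rw [Set.indicator_of_mem hv]
          exact prob_le_one.trans le_self_add
        · have : ∃ b, v b ∉ A := by
            by_contra hcon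
            push Not at hcon
            exact hv fun b _ => hcon b
          obtain ⟨b, hb⟩ := this
          refine le_trans ?_ ((hgood (v b) hb).trans le_add_self)
          exact measure_mono fun U hU => hU b
    _ ≤ stdGaussian n A ^ d + q := by
        rw [lintegral_add_right _ measurable_const, lintegral_const, measure_univ, mul_one]
        refine add_le_add ((lintegral_indicator_one_le _).trans ?_) le_rfl
        rw [Measure.pi_pi]
        simp
    _ ≤ ENNReal.ofReal (Real.exp w) ^ d + q := by gcongr
    _ = ENNReal.ofReal (T1 + T2 + T3) := by
        rw [ENNReal.ofReal_add (by positivity) hT3p.le, ENNReal.ofReal_add hT1p.le hT2p.le, hT3e,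
          ENNReal.ofReal_pow (Real.exp_pos _).le, add_comm]


end ReproSamples
end
end

section
/- Let Θ denote the set of triples θ = (τ, β_τ, σ) with τ ⊆ {1,…,p}, β_τ ∈ ℝ^{|τ|}, σ > 0, and for θ ∈ Θ set Y_θ = X_τβ_τ + σU, where U ~ N(0, I_n). Let T be a measurable nuclear mapping defined on ℝⁿ × Θ, W a measurable mapping defined on ℝⁿ × Θ, and for each level α ∈ (0,1) let {B_α(τ, w)} be a family of measurable sets such that for every θ = (τ, β_τ, σ), the conditional probability ℙ{T(U, θ) ∈ B_α(τ, w) | W(U, θ) = w} ≥ α for almost every w (with respect to the law of W(U,θ)), and such that this conditional distribution does not depend on (β_τ, σ). Define the confidence set Γ^τ_α(y) = {τ : there exist u* ∈ ℝⁿ and (β_τ, σ) with y = X_τβ_τ + σu* and T(u*, θ) ∈ B_α(τ, W(u*, θ)) for θ = (τ, β_τ, σ)}. Then for the random data Y = X_{τ₀}β₀ + σ₀U, the coverage satisfies ℙ(τ₀ ∈ Γ^τ_α(Y)) ≥ α. -/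
open MeasureTheory ProbabilityTheory Matrix Filter
open scoped ENNReal Classical

noncomputable section

namespace ReproSamples

/-- **Theorem 2.3.** Validity of the conditional repro-samples confidence set for
the true model: if the conditional probability of `T(U,θ) ∈ B_α(τ, W(U,θ))` given
`W(U,θ)` is at least `α` (a.e.) for every parameter `θ = (τ, β_τ, σ)`, and this
conditional probability does not depend on the nuisance parameters `(β_τ, σ)`,
then `ℙ(τ₀ ∈ Γ^τ_α(Y)) ≥ α`. -/
theorem conditional_repro_samples_coverage {n p : ℕ}
    (X : Matrix (Fin n) (Fin p) ℝ) (τ₀ : Finset (Fin p)) (β₀ : Fin p → ℝ)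
    (hβsupp : ∀ j ∉ τ₀, β₀ j = 0) (hβne : ∀ j ∈ τ₀, β₀ j ≠ 0)
    (σ₀ : ℝ) (hσ₀ : 0 < σ₀)
    {𝒯 𝒲 : Type} [MeasurableSpace 𝒯] [MeasurableSpace 𝒲]
    (T : (Fin n → ℝ) → Finset (Fin p) × (Fin p → ℝ) × ℝ → 𝒯)
    (W : (Fin n → ℝ) → Finset (Fin p) × (Fin p → ℝ) × ℝ → 𝒲)
    (hT : ∀ θ, Measurable fun u => T u θ)
    (hW : ∀ θ, Measurable fun u => W u θ)
    (α : ℝ) (hα : α ∈ Set.Ioo (0 : ℝ) 1)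
    (B : Finset (Fin p) → 𝒲 → Set 𝒯)
    (hB : ∀ τ w, MeasurableSet (B τ w))
    -- the conditional probability that `T(U,θ) ∈ B_α(τ, w)` given `W(U,θ) = w`
    -- is at least `α` for a.e. `w`:
    (hcond : ∀ θ : Finset (Fin p) × (Fin p → ℝ) × ℝ, 0 < θ.2.2 →
      ∀ᵐ u ∂ stdGaussian n,
        α ≤ ((stdGaussian n)[Set.indicator {v | T v θ ∈ B θ.1 (W v θ)}
              (fun _ => (1 : ℝ)) |
              MeasurableSpace.comap (fun v => W v θ) inferInstance]) u)
    -- this conditional distribution is free of the nuisance parameters `(β_τ, σ)`: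
    (hfree : ∃ κ : Finset (Fin p) → 𝒲 → ℝ,
      ∀ θ : Finset (Fin p) × (Fin p → ℝ) × ℝ, 0 < θ.2.2 →
        ((stdGaussian n)[Set.indicator {v | T v θ ∈ B θ.1 (W v θ)}
            (fun _ => (1 : ℝ)) |
            MeasurableSpace.comap (fun v => W v θ) inferInstance])
          =ᵐ[stdGaussian n] fun u => κ θ.1 (W u θ)) :
    ENNReal.ofReal α ≤
      stdGaussian n
        {u | ∃ (ustar : Fin n → ℝ) (β : Fin p → ℝ) (σ : ℝ), 0 < σ ∧
          X.mulVec β₀ + σ₀ • u = X.mulVec (maskOn τ₀ β) + σ • ustar ∧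
          T ustar (τ₀, maskOn τ₀ β, σ) ∈ B τ₀ (W ustar (τ₀, maskOn τ₀ β, σ))} := by
  haveI : IsProbabilityMeasure (stdGaussian n) := by
    unfold stdGaussian; infer_instance
  have hmask : maskOn τ₀ β₀ = β₀ := by
    funext j
    by_cases hj : j ∈ τ₀
    · simp [maskOn, hj]
    · simp [maskOn, hj, hβsupp j hj]
  have hc := hcond (τ₀, β₀, σ₀) hσ₀
  have hm : MeasurableSpace.comap (fun v => W v (τ₀, β₀, σ₀)) inferInstance
      ≤ (inferInstance : MeasurableSpace (Fin n → ℝ)) := (hW (τ₀, β₀, σ₀)).comap_le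
  have h1 := integral_mono_ae (integrable_const α) integrable_condExp hc
  rw [integral_condExp hm] at h1
  simp only [integral_const, probReal_univ, one_smul] at h1
  set S : Set (Fin n → ℝ) := {v | T v (τ₀, β₀, σ₀) ∈ B τ₀ (W v (τ₀, β₀, σ₀))} with hS
  have hint : Integrable (S.indicator (fun _ => (1 : ℝ))) (stdGaussian n) := by
    by_contra hni
    rw [integral_undef hni] at h1
    exact absurd hα.1 (not_lt.mpr h1)
  calc ENNReal.ofReal α
      ≤ ENNReal.ofReal (∫ u, S.indicator (fun _ => (1 : ℝ)) u ∂ stdGaussian n) :=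
        ENNReal.ofReal_le_ofReal h1
    _ = ∫⁻ u, ENNReal.ofReal (S.indicator (fun _ => (1 : ℝ)) u) ∂ stdGaussian n :=
        ofReal_integral_eq_lintegral_ofReal hint
          (Eventually.of_forall fun u => Set.indicator_nonneg (fun _ _ => zero_le_one) u)
    _ = ∫⁻ u, S.indicator 1 u ∂ stdGaussian n := by
        congr 1
        funext u
        by_cases hu : u ∈ S <;> simp [hu]
    _ ≤ stdGaussian n S := lintegral_indicator_one_le S
    _ ≤ _ := by
        apply measure_mono
        intro u hu
        refine ⟨u, β₀, σ₀, hσ₀, ?_, ?_⟩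
        · rw [hmask]
        · rw [hmask]; exact hu

end ReproSamples
end
end
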